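/- Assume a^ε ∈ C(Q̄; 𝕊ⁿ(θ₀)) and that b is Lipschitz with Lipschitz constant L_b and b(0)=0, so that |b(x)| ≤ L_b|x| on B_{r₀}. For ε ∈ (0,1), let u^ε ∈ C(Q̄) ∩ C^{2,1}(Q) be a classical solution of (L) in Q. Fix m ∈ ℕ and T > 0 and assume (m+2)√ε ≤ r₀, T > 4(m+1), u^ε(0,t) ≤ 0 for all t ∈ (0,T), and u^ε(x,t) ≤ 1 for all (x,t) ∈ B_{(m+2)√ε}×(0,T). Then there exists a constant η = η(m,θ₀,L_b,n) ∈ (0,1) such that u^ε ≤ η on B_{m√ε} × (4(m+1), T). -/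

import Mathlib

open Set Filter Metric Topology
open scoped ENNReal

noncomputable section

/-- `n`-dimensional Euclidean space. -/
abbrev Eu (n : ℕ) := EuclideanSpace ℝ (Fin n)

variable {n : ℕ}

/-- Euclidean dot product. -/
def dotp (x y : Eu n) : ℝ := ∑ i, x i * y i

/-- The quadratic form `A p · p` of a matrix `A`. -/
def mquad (A : Matrix (Fin n) (Fin n) ℝ) (p : Eu n) : ℝ := ∑ i, ∑ j, A i j * p i * p j

/-- `A ∈ 𝕊ⁿ(θ)`: symmetric with `θ I ≤ A ≤ θ⁻¹ I`. -/
def memS (θ : ℝ) (A : Matrix (Fin n) (Fin n) ℝ) : Prop :=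
  A.IsSymm ∧ ∀ p : Eu n, θ * ‖p‖ ^ 2 ≤ mquad A p ∧ mquad A p ≤ θ⁻¹ * ‖p‖ ^ 2

/-- order of symmetric matrices (via quadratic forms). -/
def mle (A B : Matrix (Fin n) (Fin n) ℝ) : Prop := ∀ p : Eu n, mquad A p ≤ mquad B p

/-- trace of the product `A·H`. -/
def trMul (A H : Matrix (Fin n) (Fin n) ℝ) : ℝ := ∑ i, ∑ j, A i j * H j i

/-- the Pucci maximal operator associated with `𝕊ⁿ(θ)`. -/
def pucci (θ : ℝ) (X : Matrix (Fin n) (Fin n) ℝ) : ℝ :=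
  sSup ((fun A => trMul A X) '' {A | memS θ A})

/-- time derivative of `u(x,t)`. -/
def tD (u : Eu n → ℝ → ℝ) (x : Eu n) (t : ℝ) : ℝ := deriv (u x) t

/-- spatial gradient of `u(x,t)`. -/
def sG (u : Eu n → ℝ → ℝ) (x : Eu n) (t : ℝ) : Eu n := gradient (fun y => u y t) x

/-- spatial Hessian matrix of `u(x,t)`. -/
def sH (u : Eu n → ℝ → ℝ) (x : Eu n) (t : ℝ) : Matrix (Fin n) (Fin n) ℝ :=
  fun i j => fderiv ℝ (fun y => sG u y t i) x (EuclideanSpace.single j 1)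

/-- Hessian matrix of a static function. -/
def hessS (v : Eu n → ℝ) (x : Eu n) : Matrix (Fin n) (Fin n) ℝ :=
  fun i j => fderiv ℝ (fun y => gradient v y i) x (EuclideanSpace.single j 1)

/-- closed parabolic cylinder `Q̄_T = closure Ω × [0,T]` (with `T ∈ (0,∞]`). -/
def cylC (Ω : Set (Eu n)) (T : ℝ≥0∞) : Set (Eu n × ℝ) :=
  {p | p.1 ∈ closure Ω ∧ 0 ≤ p.2 ∧ ENNReal.ofReal p.2 ≤ T}

/-- open parabolic cylinder `Q_T = Ω × (0,T)`. -/
def cylO (Ω : Set (Eu n)) (T : ℝ≥0∞) : Set (Eu n × ℝ) :=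
  {p | p.1 ∈ Ω ∧ 0 < p.2 ∧ ENNReal.ofReal p.2 < T}

/-- `u ∈ C^{2,1}(Q_T)`. -/
def C21 (u : Eu n → ℝ → ℝ) (Ω : Set (Eu n)) (T : ℝ≥0∞) : Prop :=
  (∀ x ∈ Ω, ∀ t : ℝ, 0 < t → ENNReal.ofReal t < T →
     ContDiffAt ℝ 2 (fun y => u y t) x ∧ DifferentiableAt ℝ (u x) t) ∧
  ContinuousOn (fun p : Eu n × ℝ => tD u p.1 p.2) (cylO Ω T) ∧
  ContinuousOn (fun p : Eu n × ℝ => sH u p.1 p.2) (cylO Ω T)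

/-- `u ∈ C(Q̄_T) ∩ C^{2,1}(Q_T)`. -/
def Classical21 (u : Eu n → ℝ → ℝ) (Ω : Set (Eu n)) (T : ℝ≥0∞) : Prop :=
  ContinuousOn (fun p : Eu n × ℝ => u p.1 p.2) (cylC Ω T) ∧ C21 u Ω T

/-- a coefficient field in `C(Q̄_T; 𝕊ⁿ(θ))`. -/
def MatC (θ : ℝ) (A : Eu n → ℝ → Matrix (Fin n) (Fin n) ℝ) (Ω : Set (Eu n))
    (T : ℝ≥0∞) : Prop :=
  ContinuousOn (fun p : Eu n × ℝ => A p.1 p.2) (cylC Ω T) ∧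
  ∀ p ∈ cylC Ω T, memS θ (A p.1 p.2)

/-- `u` is a classical solution of `u_t = ε tr[A D²u] + b·Du` in `Q_T`. -/
def SolveL (ε : ℝ) (A : Eu n → ℝ → Matrix (Fin n) (Fin n) ℝ) (b : Eu n → Eu n)
    (u : Eu n → ℝ → ℝ) (Ω : Set (Eu n)) (T : ℝ≥0∞) : Prop :=
  ∀ x ∈ Ω, ∀ t : ℝ, 0 < t → ENNReal.ofReal t < T →
    tD u x t = ε * trMul (A x t) (sH u x t) + dotp (b x) (sG u x t)

/-- `u` is a classical subsolution of `(L)` in `Q_T`. -/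
def SubsolL (ε : ℝ) (A : Eu n → ℝ → Matrix (Fin n) (Fin n) ℝ) (b : Eu n → Eu n)
    (u : Eu n → ℝ → ℝ) (Ω : Set (Eu n)) (T : ℝ≥0∞) : Prop :=
  ∀ x ∈ Ω, ∀ t : ℝ, 0 < t → ENNReal.ofReal t < T →
    tD u x t ≤ ε * trMul (A x t) (sH u x t) + dotp (b x) (sG u x t)

/-- `u` is a classical supersolution of `(L)` in `Q_T`. -/
def SupersolL (ε : ℝ) (A : Eu n → ℝ → Matrix (Fin n) (Fin n) ℝ) (b : Eu n → Eu n)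
    (u : Eu n → ℝ → ℝ) (Ω : Set (Eu n)) (T : ℝ≥0∞) : Prop :=
  ∀ x ∈ Ω, ∀ t : ℝ, 0 < t → ENNReal.ofReal t < T →
    ε * trMul (A x t) (sH u x t) + dotp (b x) (sG u x t) ≤ tD u x t

/-- viscosity subsolution of `H(x,Du) = 0` on `A`. -/
def ViscSub (H : Eu n → Eu n → ℝ) (A : Set (Eu n)) (u : Eu n → ℝ) : Prop :=
  ∀ φ : Eu n → ℝ, ContDiff ℝ 1 φ → ∀ x ∈ A,
    IsLocalMaxOn (fun y => u y - φ y) A x → H x (gradient φ x) ≤ 0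

/-- viscosity supersolution of `H(x,Du) = 0` on `A`. -/
def ViscSup (H : Eu n → Eu n → ℝ) (A : Set (Eu n)) (u : Eu n → ℝ) : Prop :=
  ∀ φ : Eu n → ℝ, ContDiff ℝ 1 φ → ∀ x ∈ A,
    IsLocalMinOn (fun y => u y - φ y) A x → 0 ≤ H x (gradient φ x)

/-- the Hamiltonian `H_α(x,p) = α(x) p·p + b(x)·p`. -/
def Ham (α : Eu n → Matrix (Fin n) (Fin n) ℝ) (b : Eu n → Eu n) (x p : Eu n) : ℝ :=
  mquad (α x) p + dotp (b x) p

/-- the quasi-potential `V_α`: the pointwise supremum (= maximal element) of all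
Lipschitz viscosity subsolutions of `H_α(x,Du)=0` in `Ω` vanishing at the origin. -/
def Vq (α : Eu n → Matrix (Fin n) (Fin n) ℝ) (b : Eu n → Eu n) (Ω : Set (Eu n))
    (x : Eu n) : ℝ :=
  sSup {r | ∃ u : Eu n → ℝ, (∃ K : NNReal, LipschitzOnWith K u (closure Ω)) ∧
    u 0 = 0 ∧ ViscSub (Ham α b) Ω u ∧ r = u x}

/-- `M_α = min_{∂Ω} V_α`. -/
def Mq (α : Eu n → Matrix (Fin n) (Fin n) ℝ) (b : Eu n → Eu n) (Ω : Set (Eu n)) : ℝ :=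
  sInf (Vq α b Ω '' frontier Ω)

/-- `argmin (V_α | ∂Ω)`. -/
def argminV (α : Eu n → Matrix (Fin n) (Fin n) ℝ) (b : Eu n → Eu n)
    (Ω : Set (Eu n)) : Set (Eu n) :=
  {x ∈ frontier Ω | ∀ y ∈ frontier Ω, Vq α b Ω x ≤ Vq α b Ω y}

/-- `Σ_α^m = {x ∈ Ω̄ : V_α(x) ≤ m}`. -/
def SigmaM (α : Eu n → Matrix (Fin n) (Fin n) ℝ) (b : Eu n → Eu n) (Ω : Set (Eu n))
    (m : ℝ) : Set (Eu n) :=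
  {x ∈ closure Ω | Vq α b Ω x ≤ m}

/-- `Ω` is a bounded `C¹` domain with outward unit normal `ν`. -/
def IsBdC1With (Ω : Set (Eu n)) (ν : Eu n → Eu n) : Prop :=
  IsOpen Ω ∧ Bornology.IsBounded Ω ∧
  ∃ ρ : Eu n → ℝ, ContDiff ℝ 1 ρ ∧ Ω = {x | ρ x < 0} ∧
    ∀ x ∈ frontier Ω, gradient ρ x ≠ 0 ∧ ν x = ‖gradient ρ x‖⁻¹ • gradient ρ x

/-- `X` is the flow of `b`, and the origin is globally asymptotically stable. -/
def GAS (b : Eu n → Eu n) (X : ℝ → Eu n → Eu n) : Prop :=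
  (∀ x, X 0 x = x) ∧ (∀ x t, HasDerivAt (fun s => X s x) (b (X t x)) t) ∧
  (∀ x, Tendsto (fun t => X t x) atTop (nhds 0)) ∧
  (∀ ε > (0:ℝ), ∃ δ > (0:ℝ), ∀ x : Eu n, ‖x‖ < δ → ∀ t ≥ (0:ℝ), ‖X t x‖ < ε)

/-- `Ω_δ = {x ∈ Ω : dist(x,∂Ω) > δ}`. -/
def Omd (Ω : Set (Eu n)) (δ : ℝ) : Set (Eu n) := {x ∈ Ω | δ < infDist x (frontier Ω)}

/-- `Ω^Π_δ = {x ∈ Ω̄ : dist(x, ∂Ω \ Π) > δ}`. -/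
def OmPid (Ω Pset : Set (Eu n)) (δ : ℝ) : Set (Eu n) :=
  {x ∈ closure Ω | δ < infDist x (frontier Ω \ Pset)}

/-- the standing assumptions (B). -/
structure SettingB (n : ℕ) where
  Ω : Set (Eu n)
  ν : Eu n → Eu n
  g : Eu n → ℝ
  θ₀ : ℝ
  a : Eu n → ℝ → Matrix (Fin n) (Fin n) ℝ
  b : Eu n → Eu n
  b₀ : ℝ
  r₀ : ℝ
  θ₀_mem : θ₀ ∈ Set.Ioc (0 : ℝ) 1
  domain : IsBdC1With Ω ν
  zero_mem : (0 : Eu n) ∈ Ω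
  g_cont : ContinuousOn g (closure Ω)
  a_cont : ContinuousOn (fun p : Eu n × ℝ => a p.1 p.2) (closure Ω ×ˢ Set.univ)
  a_mem : ∀ x ∈ closure Ω, ∀ c : ℝ, memS θ₀ (a x c)
  b_lip : ∃ K : NNReal, LipschitzWith K b
  b_zero : b 0 = 0
  b_gas : ∃ X : ℝ → Eu n → Eu n, GAS b X
  b_inward : ∀ x ∈ frontier Ω, dotp (b x) (ν x) < 0
  b₀_pos : 0 < b₀
  r₀_pos : 0 < r₀
  ball_sub : closedBall (0 : Eu n) r₀ ⊆ Ω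
  b_coerc : ∀ x ∈ ball (0 : Eu n) r₀, dotp (b x) x ≤ -b₀ * ‖x‖ ^ 2

namespace SettingB

variable (S : SettingB n)

/-- the quasi-potential `V^c` associated with `(a(·,c), b)`. -/
def Vc (c : ℝ) : Eu n → ℝ := Vq (fun x => S.a x c) S.b S.Ω

/-- `M(c) = min_{∂Ω} V^c`. -/
def M (c : ℝ) : ℝ := sInf (S.Vc c '' frontier S.Ω)

/-- `G(c) = {g(x) : x ∈ argmin(V^c|∂Ω)}`. -/
def Gset (c : ℝ) : Set ℝ := S.g '' argminV (fun x => S.a x c) S.b S.Ω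

/-- `G⁺(c) = max G(c)`. -/
def Gp (c : ℝ) : ℝ := sSup (S.Gset c)

/-- `G⁻(c) = min G(c)`. -/
def Gm (c : ℝ) : ℝ := sInf (S.Gset c)

/-- `c₀ = g(0)`. -/
def c0 : ℝ := S.g 0

/-- `g_min = min_{Ω̄} g`. -/
def gmin : ℝ := sInf (S.g '' closure S.Ω)

/-- `g_max = max_{Ω̄} g`. -/
def gmax : ℝ := sSup (S.g '' closure S.Ω)

/-- the crossing value `c₁`. -/
def c1 : ℝ :=
  if S.c0 ≤ S.Gp S.c0 then sInf {c | S.c0 ≤ c ∧ S.Gm c ≤ c}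
  else sSup {c | c ≤ S.c0 ∧ c ≤ S.Gp c}

/-- the function `c̄ : (0,∞) → I_g`. -/
def cbar (l : ℝ) : ℝ :=
  if l < S.M S.c0 ∨ S.c1 = S.c0 then S.c0
  else if S.c0 < S.c1 then min S.c1 (sInf {c | c ∈ Set.Icc S.c0 S.c1 ∧ S.M c = l})
  else max S.c1 (sSup {c | c ∈ Set.Icc S.c1 S.c0 ∧ S.M c = l})

/-- assumption (FK13): `G⁺(c₀) = G⁻(c₀)`. -/
def FK13 : Prop := S.Gp S.c0 = S.Gm S.c0

/-- assumption (FK12). -/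
def FK12 : Prop :=
  ∀ δ₀ > (0:ℝ), ∃ δ ∈ Set.Ioc (0:ℝ) δ₀,
    (S.c1 ≤ S.c0 ∧ S.gmin < S.c1 → S.c1 - δ < S.Gm (S.c1 - δ)) ∧
    (S.c0 ≤ S.c1 ∧ S.c1 < S.gmax → S.Gp (S.c1 + δ) < S.c1 + δ)

/-- `u` is a classical (`C(Q̄) ∩ C^{2,1}(Q)`) solution of the quasi-linear equation (QL). -/
def SolvesQL (ε : ℝ) (u : Eu n → ℝ → ℝ) : Prop :=
  Classical21 u S.Ω ⊤ ∧ SolveL ε (fun x t => S.a x (u x t)) S.b u S.Ω ⊤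

/-- the boundary condition (BC): `u = g` on the parabolic boundary of `Q`. -/
def BC (u : Eu n → ℝ → ℝ) : Prop :=
  (∀ x ∈ closure S.Ω, u x 0 = S.g x) ∧ ∀ x ∈ frontier S.Ω, ∀ t > (0:ℝ), u x t = S.g x

end SettingB

/-! ### Pointwise calculus -/

lemma ks_second_deriv_nonneg {f : ℝ → ℝ} {x : ℝ} (h : IsLocalMin f x)
    (hc : ContinuousAt f x) : 0 ≤ deriv (deriv f) x := by
  by_contra hneg
  push Not at hneg
  have hmax := isLocalMax_of_deriv_deriv_neg hneg h.deriv_eq_zero hc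
  have hconst : f =ᶠ[𝓝 x] fun _ => f x := by
    filter_upwards [h, hmax] with y h1 h2
    exact le_antisymm h2 h1
  have h1 : deriv f =ᶠ[𝓝 x] fun _ => 0 := by
    refine hconst.deriv.trans ?_
    simp
  have h2 : deriv (deriv f) x = 0 := by
    rw [h1.deriv_eq]; simp
  linarith

lemma ks_dotp_eq (x y : Eu n) : dotp x y = inner ℝ x y := by
  simp [dotp, PiLp.inner_apply, mul_comm]

lemma ks_grad_diff {f : Eu n → ℝ} {x : Eu n} (hf : ContDiffAt ℝ 2 f x) :
    ContDiffAt ℝ 1 (gradient f) x := by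
  have h1 : ContDiffAt ℝ 1 (fderiv ℝ f) x := hf.fderiv_right (by norm_num)
  exact ((InnerProductSpace.toDual ℝ (Eu n)).symm.contDiff.contDiffAt (n := 1)).comp x h1

lemma ks_hess_apply {f : Eu n → ℝ} {x : Eu n} (hf : ContDiffAt ℝ 2 f x) (i j : Fin n) :
    hessS f x i j = (fderiv ℝ (gradient f) x (EuclideanSpace.single j 1)) i := by
  have hd : DifferentiableAt ℝ (gradient f) x := (ks_grad_diff hf).differentiableAt (by norm_num)
  have h2 := ((EuclideanSpace.proj i : Eu n →L[ℝ] ℝ).hasFDerivAt).comp x hd.hasFDerivAt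
  have h3 : (fun y => gradient f y i) =
    (⇑(EuclideanSpace.proj i : Eu n →L[ℝ] ℝ) ∘ gradient f) := by
    ext y; simp
  simp only [hessS]
  rw [h3, h2.fderiv]
  simp

lemma ks_hess_symm {f : Eu n → ℝ} {x : Eu n} (hf : ContDiffAt ℝ 2 f x) (i j : Fin n) :
    hessS f x i j = hessS f x j i := by
  have hs := hf.isSymmSndFDerivAt (by simp)
  have hd : DifferentiableAt ℝ (fderiv ℝ f) x :=
    (hf.fderiv_right (m := 1) (by norm_num)).differentiableAt (by norm_num)
  have key : ∀ a b : Fin n, hessS f x a b =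
      fderiv ℝ (fderiv ℝ f) x (EuclideanSpace.single b 1) (EuclideanSpace.single a 1) := by
    intro a b
    have h3 : (fun y => gradient f y a) = fun y => fderiv ℝ f y (EuclideanSpace.single a 1) := by
      ext y
      have : fderiv ℝ f y (EuclideanSpace.single a 1) =
        inner ℝ (gradient f y) (EuclideanSpace.single a 1) := by
        simp [gradient]
      rw [this, EuclideanSpace.inner_single_right]; simp
    simp only [hessS]
    rw [h3]
    have := hd.hasFDerivAt.clm_apply (hasFDerivAt_const (EuclideanSpace.single a (1:ℝ) : Eu n) x)
    rw [this.fderiv]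
    simp
  rw [key, key, hs.eq]

lemma ks_single_sum (p : Eu n) : p = ∑ j, p j • (EuclideanSpace.single j (1:ℝ) : Eu n) := by
  ext i
  simp [Finset.sum_apply, Pi.single_apply]

lemma ks_hess_mquad {f : Eu n → ℝ} {x : Eu n} (hf : ContDiffAt ℝ 2 f x) (p : Eu n) :
    mquad (hessS f x) p = inner ℝ (fderiv ℝ (gradient f) x p) p := by
  have : fderiv ℝ (gradient f) x p
      = ∑ j, p j • fderiv ℝ (gradient f) x (EuclideanSpace.single j (1:ℝ)) := by
    conv_lhs => rw [ks_single_sum p]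
    simp
  rw [← ks_dotp_eq, dotp, this, mquad]
  refine Finset.sum_congr rfl fun i _ => ?_
  simp only [WithLp.ofLp_sum, Finset.sum_apply, PiLp.smul_apply, smul_eq_mul, Finset.sum_mul]
  refine Finset.sum_congr rfl fun j _ => ?_
  rw [ks_hess_apply hf]
  simp; ring

/-- Testing a `C²` function from below along a line with a quartic polynomial. -/
lemma ks_line_test {f : Eu n → ℝ} {x : Eu n} (hf : ContDiffAt ℝ 2 f x) (p : Eu n)
    (a0 a1 a2 a3 a4 : ℝ)
    (hmin : IsLocalMin (fun τ : ℝ => f (x + τ • p) -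
      (a0 + a1 * τ + a2 * τ ^ 2 + a3 * τ ^ 3 + a4 * τ ^ 4)) 0) :
    inner ℝ (gradient f x) p = a1 ∧ 2 * a2 ≤ mquad (hessS f x) p := by
  have hgx : ∀ᶠ y in 𝓝 x, DifferentiableAt ℝ f y := by
    filter_upwards [hf.eventually (by simp)] with y hy
    exact hy.differentiableAt (by norm_num)
  have hline : Tendsto (fun τ : ℝ => x + τ • p) (𝓝 0) (𝓝 x) := by
    have : Continuous (fun τ : ℝ => x + τ • p) := by fun_prop
    simpa using this.tendsto 0
  have hl : ∀ τ : ℝ, HasDerivAt (fun τ : ℝ => x + τ • p) p τ := by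
    intro τ
    simpa using ((hasDerivAt_id τ).smul_const p).const_add x
  set g := (fun τ : ℝ => f (x + τ • p) -
      (a0 + a1 * τ + a2 * τ ^ 2 + a3 * τ ^ 3 + a4 * τ ^ 4)) with hg
  have hpoly : ∀ τ : ℝ, HasDerivAt (fun τ : ℝ =>
      (a0 + a1 * τ + a2 * τ ^ 2 + a3 * τ ^ 3 + a4 * τ ^ 4))
      (a1 + 2 * a2 * τ + 3 * a3 * τ ^ 2 + 4 * a4 * τ ^ 3) τ := by
    intro τ
    have h1 := (hasDerivAt_id τ).const_mul a1
    have h2 := (hasDerivAt_pow 2 τ).const_mul a2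
    have h3 := (hasDerivAt_pow 3 τ).const_mul a3
    have h4 := (hasDerivAt_pow 4 τ).const_mul a4
    have := ((((h1.const_add a0).add h2).add h3).add h4)
    refine this.congr_deriv ?_
    simp only [Nat.cast_ofNat, Nat.add_one_sub_one]; norm_num; ring
  have hder : ∀ᶠ τ in 𝓝 (0:ℝ), HasDerivAt g (inner ℝ (gradient f (x + τ • p)) p -
      (a1 + 2 * a2 * τ + 3 * a3 * τ ^ 2 + 4 * a4 * τ ^ 3)) τ := by
    filter_upwards [hline.eventually hgx] with τ hτ
    have h1 := hτ.hasGradientAt.hasFDerivAt.comp_hasDerivAt τ (hl τ)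
    refine (h1.sub (hpoly τ)).congr_deriv ?_
    simp [gradient]
  have hd1 : deriv g 0 = 0 := hmin.deriv_eq_zero
  have h0 := hder.self_of_nhds
  constructor
  · have := h0.deriv
    rw [hd1] at this
    simp only [zero_smul, add_zero] at this
    linarith
  · have hc : ContinuousAt g 0 := h0.continuousAt
    have h2 := ks_second_deriv_nonneg hmin hc
    have heq : deriv g =ᶠ[𝓝 0] fun τ => inner ℝ (gradient f (x + τ • p)) p -
      (a1 + 2 * a2 * τ + 3 * a3 * τ ^ 2 + 4 * a4 * τ ^ 3) := by
      filter_upwards [hder] with τ hτ using hτ.deriv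
    rw [heq.deriv_eq] at h2
    have hdg : DifferentiableAt ℝ (gradient f) (x + (0:ℝ) • p) := by
      simpa using (ks_grad_diff hf).differentiableAt (by norm_num)
    have e1 := hdg.hasFDerivAt.comp_hasDerivAt (0:ℝ) (hl 0)
    have e2 : HasDerivAt (fun τ : ℝ => inner ℝ (gradient f (x + τ • p)) p)
        (inner ℝ (fderiv ℝ (gradient f) (x + (0:ℝ) • p) p) p) 0 := by
      have := e1.inner ℝ (hasDerivAt_const (0:ℝ) p)
      simpa using this
    have e3 : HasDerivAt (fun τ : ℝ => (a1 + 2 * a2 * τ + 3 * a3 * τ ^ 2 + 4 * a4 * τ ^ 3))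
        (2 * a2) 0 := by
      have h1 := (hasDerivAt_id (0:ℝ)).const_mul (2 * a2)
      have h2 := (hasDerivAt_pow 2 (0:ℝ)).const_mul (3 * a3)
      have h3 := (hasDerivAt_pow 3 (0:ℝ)).const_mul (4 * a4)
      have := (((h1.const_add a1).add h2).add h3)
      refine this.congr_deriv ?_
      simp
    have e4 : HasDerivAt (fun τ : ℝ => inner ℝ (gradient f (x + τ • p)) p -
      (a1 + 2 * a2 * τ + 3 * a3 * τ ^ 2 + 4 * a4 * τ ^ 3)) _ 0 := e2.sub e3
    rw [e4.deriv] at h2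
    rw [ks_hess_mquad hf]
    simp only [zero_smul, add_zero] at h2
    linarith

/-! ### Matrices -/

lemma ks_mquad_dot (A : Matrix (Fin n) (Fin n) ℝ) (p : Eu n) :
    mquad A p = dotProduct (fun i => p i) (A.mulVec (fun i => p i)) := by
  simp only [mquad, dotProduct, Matrix.mulVec, Finset.mul_sum]
  refine Finset.sum_congr rfl fun i _ => Finset.sum_congr rfl fun j _ => by ring

lemma ks_psd {A : Matrix (Fin n) (Fin n) ℝ} (hs : A.IsSymm) (h : ∀ p : Eu n, 0 ≤ mquad A p) :
    A.PosSemidef := by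
  refine Matrix.PosSemidef.of_dotProduct_mulVec_nonneg ?_ ?_
  · rw [Matrix.IsHermitian, Matrix.conjTranspose_eq_transpose_of_trivial]; exact hs
  · intro x
    have := h (WithLp.toLp 2 x)
    rw [ks_mquad_dot] at this
    simpa using this

lemma ks_trMul_nonneg {A M : Matrix (Fin n) (Fin n) ℝ} (hs : A.IsSymm)
    (h : ∀ p : Eu n, 0 ≤ mquad A p) (hM : ∀ p : Eu n, 0 ≤ mquad M p) : 0 ≤ trMul A M := by
  obtain ⟨B, hB⟩ : ∃ B : Matrix (Fin n) (Fin n) ℝ, A = B.conjTranspose * B := by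
    open scoped MatrixOrder in
    exact CStarAlgebra.nonneg_iff_eq_star_mul_self.mp (Matrix.nonneg_iff_posSemidef.mpr (ks_psd hs h))
  have : trMul A M = ∑ k, mquad M (WithLp.toLp 2 (fun i => B k i)) := by
    simp only [trMul, mquad, hB, Matrix.mul_apply, Matrix.conjTranspose_apply, star_trivial,
      Finset.sum_mul]
    calc _ = ∑ i, ∑ k, ∑ j, B k i * B k j * M j i := by
          refine Finset.sum_congr rfl fun i _ => Finset.sum_comm
      _ = ∑ k, ∑ i, ∑ j, B k i * B k j * M j i := Finset.sum_comm
      _ = _ := by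
          refine Finset.sum_congr rfl fun k _ => ?_
          rw [Finset.sum_comm]
          refine Finset.sum_congr rfl fun i _ => Finset.sum_congr rfl fun j _ => by ring
  rw [this]
  exact Finset.sum_nonneg fun k _ => hM _

lemma ks_norm_sq (p : Eu n) : ‖p‖ ^ 2 = ∑ i, p i ^ 2 := by
  rw [EuclideanSpace.norm_sq_eq]; simp

lemma ks_mquad_one (c : ℝ) (p : Eu n) : mquad (c • (1 : Matrix (Fin n) (Fin n) ℝ)) p = c * ‖p‖ ^ 2 := by
  simp only [mquad, Matrix.smul_apply, Matrix.one_apply, ks_norm_sq, Finset.mul_sum]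
  refine Finset.sum_congr rfl fun i _ => ?_
  rw [Finset.sum_eq_single i]
  · simp; ring
  · intro j _ hj; simp [hj.symm]
  · simp

lemma ks_mquad_add (A B : Matrix (Fin n) (Fin n) ℝ) (p : Eu n) :
    mquad (A + B) p = mquad A p + mquad B p := by
  simp only [mquad, Matrix.add_apply, ← Finset.sum_add_distrib]
  refine Finset.sum_congr rfl fun i _ => Finset.sum_congr rfl fun j _ => by ring

lemma ks_mquad_smul (c : ℝ) (B : Matrix (Fin n) (Fin n) ℝ) (p : Eu n) :
    mquad (c • B) p = c * mquad B p := by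
  simp only [mquad, Matrix.smul_apply, Finset.mul_sum]
  refine Finset.sum_congr rfl fun i _ => Finset.sum_congr rfl fun j _ => by simp; ring

lemma ks_trMul_add (A B C : Matrix (Fin n) (Fin n) ℝ) :
    trMul A (B + C) = trMul A B + trMul A C := by
  simp only [trMul, Matrix.add_apply, ← Finset.sum_add_distrib]
  refine Finset.sum_congr rfl fun i _ => Finset.sum_congr rfl fun j _ => by ring

lemma ks_trMul_smul (c : ℝ) (A B : Matrix (Fin n) (Fin n) ℝ) :
    trMul A (c • B) = c * trMul A B := by
  simp only [trMul, Matrix.smul_apply, Finset.mul_sum]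
  refine Finset.sum_congr rfl fun i _ => Finset.sum_congr rfl fun j _ => by simp; ring

lemma ks_trMul_one (A : Matrix (Fin n) (Fin n) ℝ) :
    trMul A 1 = A.trace := by
  simp only [trMul, Matrix.trace, Matrix.diag]
  refine Finset.sum_congr rfl fun i _ => ?_
  rw [Finset.sum_eq_single i] <;> simp +contextual

lemma ks_trMul_comm (A B : Matrix (Fin n) (Fin n) ℝ) :
    trMul A B = trMul B A := by
  simp only [trMul]
  rw [Finset.sum_comm]
  refine Finset.sum_congr rfl fun i _ => Finset.sum_congr rfl fun j _ => by ring

lemma ks_trMul_outer (A : Matrix (Fin n) (Fin n) ℝ) (z : Eu n) :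
    trMul A (Matrix.of fun i j => z i * z j) = mquad A z := by
  simp only [trMul, mquad, Matrix.of_apply]
  refine Finset.sum_congr rfl fun i _ => Finset.sum_congr rfl fun j _ => by ring

lemma ks_mquad_outer (z p : Eu n) :
    mquad (Matrix.of fun i j => z i * z j) p = (inner ℝ z p) ^ 2 := by
  rw [← ks_dotp_eq]
  simp only [mquad, Matrix.of_apply, dotp, sq, Finset.sum_mul_sum]
  refine Finset.sum_congr rfl fun i _ => Finset.sum_congr rfl fun j _ => by ring

/-- `tr (A M) ≥ θ tr M` for `A ∈ 𝕊ⁿ(θ)` and `M ≥ 0`. -/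
lemma ks_trace_lower {θ : ℝ} {A M : Matrix (Fin n) (Fin n) ℝ} (hA : memS θ A)
    (hM : ∀ p : Eu n, 0 ≤ mquad M p) : θ * M.trace ≤ trMul A M := by
  have h := ks_trMul_nonneg (A := A + (-θ) • (1 : Matrix (Fin n) (Fin n) ℝ)) (M := M) ?_ ?_ hM
  · rw [ks_trMul_comm, ks_trMul_add, ks_trMul_smul, ks_trMul_one, ks_trMul_comm] at h
    linarith
  · refine hA.1.add ?_
    exact Matrix.IsSymm.smul Matrix.isSymm_one _
  · intro p
    rw [ks_mquad_add, ks_mquad_one]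
    have := (hA.2 p).1
    linarith

lemma ks_trace_upper {θ : ℝ} {A : Matrix (Fin n) (Fin n) ℝ} (hA : memS θ A) :
    A.trace ≤ n * θ⁻¹ := by
  have : ∀ i, A i i ≤ θ⁻¹ := by
    intro i
    have h := (hA.2 (EuclideanSpace.single i 1)).2
    have e : mquad A (EuclideanSpace.single i 1) = A i i := by
      simp only [mquad]
      rw [Finset.sum_eq_single i]
      · rw [Finset.sum_eq_single i]
        · simp
        · intro j _ hj; simp [hj]
        · simp
      · intro j _ hj; simp [hj]
      · simp
    rw [e] at h
    simpa using h
  calc A.trace = ∑ i, A i i := rfl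
    _ ≤ ∑ _i : Fin n, θ⁻¹ := Finset.sum_le_sum fun i _ => this i
    _ = _ := by simp

lemma ks_det_bound {M : Matrix (Fin n) (Fin n) ℝ} (hs : M.IsSymm)
    (h : ∀ p : Eu n, 0 ≤ mquad M p) {C : ℝ} (hC : M.trace ≤ C) : |M.det| ≤ C ^ n := by
  have hp := ks_psd hs h
  have hH := hp.isHermitian
  have hnn : ∀ i, 0 ≤ hH.eigenvalues i := fun i => hp.eigenvalues_nonneg i
  have htr : M.trace = ∑ i, hH.eigenvalues i := by
    have := hH.trace_eq_sum_eigenvalues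
    simpa using this
  have hle : ∀ i, hH.eigenvalues i ≤ C := fun i =>
    (Finset.single_le_sum (fun j _ => hnn j) (Finset.mem_univ i)).trans (htr ▸ hC)
  rw [hH.det_eq_prod_eigenvalues]
  simp only [RCLike.ofReal_real_eq_id, id_eq]
  rw [abs_of_nonneg (Finset.prod_nonneg fun i _ => hnn i)]
  calc ∏ i, hH.eigenvalues i ≤ ∏ _i : Fin n, C := Finset.prod_le_prod (fun i _ => hnn i) fun i _ => hle i
    _ = C ^ n := by simp

/-! ### Solutions of uniformly parabolic equations -/

/-- `v` is a classical solution, on the open set `U`, of some linear equation with ellipticity `θ`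
and drift bounded by `Lam`. -/
structure KSol (θ Lam : ℝ) (v : Eu n → ℝ → ℝ) (U : Set (Eu n × ℝ)) : Prop where
  isOpen : IsOpen U
  cont : ContinuousOn (fun p : Eu n × ℝ => v p.1 p.2) U
  cd : ∀ x t, (x, t) ∈ U → ContDiffAt ℝ 2 (fun y => v y t) x
  dt : ∀ x t, (x, t) ∈ U → DifferentiableAt ℝ (v x) t
  contT : ContinuousOn (fun p : Eu n × ℝ => tD v p.1 p.2) U
  eqn : ∀ x t, (x, t) ∈ U → ∃ (A : Matrix (Fin n) (Fin n) ℝ) (β : Eu n), memS θ A ∧ ‖β‖ ≤ Lam ∧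
    tD v x t = trMul A (sH v x t) + dotp β (sG v x t)

lemma ks_left_deriv {g : ℝ → ℝ} {t : ℝ} (hg : DifferentiableAt ℝ g t)
    (h : ∀ᶠ s in 𝓝[<] t, g t ≤ g s) : deriv g t ≤ 0 := by
  have hsub : Iio t ⊆ {t}ᶜ := fun s hs => ne_of_lt hs
  have h1 : Tendsto (slope g t) (𝓝[<] t) (𝓝 (deriv g t)) :=
    hg.hasDerivAt.tendsto_slope.mono_left (nhdsWithin_mono t hsub)
  refine le_of_tendsto h1 ?_
  filter_upwards [h, self_mem_nhdsWithin] with s hs hst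
  rw [slope_def_field]
  have : s - t < 0 := sub_neg.mpr hst
  exact div_nonpos_of_nonneg_of_nonpos (by linarith) this.le

/-- Spatial test at a point. -/
lemma ks_space_test {θ Lam : ℝ} {v : Eu n → ℝ → ℝ} {U : Set (Eu n × ℝ)} (hv : KSol θ Lam v U)
    {x : Eu n} {t : ℝ} (hx : (x, t) ∈ U) (z : Eu n) (c1 c2 c3 : ℝ)
    (hmin : ∀ p : Eu n, ∃ a0 a3 a4 : ℝ, IsLocalMin (fun τ : ℝ => v (x + τ • p) t -
      (a0 + (c1 * inner ℝ z p) * τ + (c2 * (inner ℝ z p) ^ 2 + c3 * ‖p‖ ^ 2) * τ ^ 2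
        + a3 * τ ^ 3 + a4 * τ ^ 4)) 0) :
    sG v x t = c1 • z ∧ ∀ p, 2 * (c2 * (inner ℝ z p) ^ 2 + c3 * ‖p‖ ^ 2) ≤ mquad (sH v x t) p := by
  have hcd := hv.cd x t hx
  have H : ∀ p : Eu n, inner ℝ (sG v x t) p = c1 * inner ℝ z p ∧
      2 * (c2 * (inner ℝ z p) ^ 2 + c3 * ‖p‖ ^ 2) ≤ mquad (sH v x t) p := by
    intro p
    obtain ⟨a0, a3, a4, h⟩ := hmin p
    exact ks_line_test hcd p _ _ _ _ _ h
  refine ⟨?_, fun p => (H p).2⟩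
  refine ext_inner_right ℝ fun p => ?_
  rw [(H p).1, real_inner_smul_left]

/-- Lower bound on the time derivative at a point touched from below. -/
lemma ks_time_lower {θ Lam : ℝ} (hθ : 0 < θ) {v : Eu n → ℝ → ℝ} {U : Set (Eu n × ℝ)}
    (hv : KSol θ Lam v U)
    {x : Eu n} {t : ℝ} (hx : (x, t) ∈ U) (z : Eu n) (c1 c2 c3 : ℝ) (hc2 : 0 ≤ c2) (hc3 : c3 ≤ 0)
    (hg : sG v x t = c1 • z)
    (hh : ∀ p, 2 * (c2 * (inner ℝ z p) ^ 2 + c3 * ‖p‖ ^ 2) ≤ mquad (sH v x t) p) :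
    2 * c2 * θ * ‖z‖ ^ 2 + 2 * c3 * (n * θ⁻¹) - Lam * |c1| * ‖z‖ ≤ tD v x t := by
  obtain ⟨A, β, hA, hβ, he⟩ := hv.eqn x t hx
  set N : Matrix (Fin n) (Fin n) ℝ := (2 * c2) • (Matrix.of fun i j => z i * z j) +
    (2 * c3) • (1 : Matrix (Fin n) (Fin n) ℝ) with hN
  have h1 : 0 ≤ trMul A (sH v x t + (-1 : ℝ) • N) := by
    refine ks_trMul_nonneg hA.1 (fun p => ?_) (fun p => ?_)
    · have := (hA.2 p).1
      have : 0 ≤ θ * ‖p‖ ^ 2 := by positivity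
      linarith
    · rw [ks_mquad_add, ks_mquad_smul, hN, ks_mquad_add, ks_mquad_smul, ks_mquad_outer,
        ks_mquad_one]
      have := hh p
      linarith
  rw [ks_trMul_add, ks_trMul_smul, hN, ks_trMul_add, ks_trMul_smul, ks_trMul_smul, ks_trMul_outer,
    ks_trMul_one] at h1
  have h2 := (hA.2 z).1
  have h3 := ks_trace_upper hA
  have h4 : -(Lam * |c1| * ‖z‖) ≤ dotp β (sG v x t) := by
    rw [ks_dotp_eq, hg, real_inner_smul_right]
    have h5 := abs_real_inner_le_norm β z
    have h6 : |c1 * inner ℝ β z| ≤ Lam * |c1| * ‖z‖ := by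
      rw [abs_mul]
      calc |c1| * |inner ℝ β z| ≤ |c1| * (‖β‖ * ‖z‖) := by gcongr
        _ ≤ |c1| * (Lam * ‖z‖) := by gcongr
        _ = _ := by ring
    have := neg_abs_le (c1 * inner ℝ β z)
    linarith
  have h5 : 2 * c2 * (θ * ‖z‖ ^ 2) ≤ 2 * c2 * mquad A z := by gcongr
  have h6 : 2 * c3 * (n * θ⁻¹) ≤ 2 * c3 * A.trace := by
    apply mul_le_mul_of_nonpos_left h3; linarith
  rw [he]
  linarith

lemma ks_barrier_alg {θ κ0 κ C0 s w : ℝ} {k : ℕ} (hθ : 0 < θ) (hκ : κ0 ≤ κ) (hs : 0 < s)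
    (hk : (C0 + 8 * θ) ^ 2 ≤ 32 * θ * (k + 2) * κ0) :
    C0 * w ≤ 8 * θ * (s - w) + (k + 2) * κ * w ^ 2 / s := by
  have h1 : (k + 2) * κ0 * w ^ 2 / s ≤ (k + 2) * κ * w ^ 2 / s := by gcongr
  have h2 : C0 * w ≤ 8 * θ * (s - w) + (k + 2) * κ0 * w ^ 2 / s := by
    have : 8 * θ * (s - w) + (k + 2) * κ0 * w ^ 2 / s - C0 * w =
      (8 * θ * s ^ 2 - (C0 + 8 * θ) * w * s + (k + 2) * κ0 * w ^ 2) / s := by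
      field_simp; ring
    have h3 : 0 ≤ (8 * θ * s ^ 2 - (C0 + 8 * θ) * w * s + (k + 2) * κ0 * w ^ 2) := by
      have h4 : 0 ≤ 32 * θ * (8 * θ * s ^ 2 - (C0 + 8 * θ) * w * s + (k + 2) * κ0 * w ^ 2) := by
        nlinarith [sq_nonneg (16 * θ * s - (C0 + 8 * θ) * w), mul_le_mul_of_nonneg_right hk (sq_nonneg w)]
      exact nonneg_of_mul_nonneg_right h4 (by positivity)
    have := div_nonneg h3 hs.le
    linarith
  linarith

set_option maxHeartbeats 3200000 in
/-- Expansion of positivity with a moving barrier. -/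
lemma ks_barrier (θ Lam τ0 τ1 D : ℝ) (hθ : 0 < θ) (hLam : 0 ≤ Lam) (hτ0 : 0 < τ0) (hτ1 : 0 < τ1)
    (hD : 0 ≤ D) : ∃ γ : ℕ, ∀ (v : Eu n → ℝ → ℝ) (U : Set (Eu n × ℝ)), KSol θ Lam v U →
    ∀ (x0 x1 : Eu n) (t0 t1 ρ α l : ℝ), 0 < ρ → ρ ≤ 1 → 0 < α → α ≤ 1 / 2 → 0 < l →
    τ0 * ρ ^ 2 ≤ t1 - t0 → t1 - t0 ≤ τ1 * ρ ^ 2 → ‖x1 - x0‖ ≤ D * ρ →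
    (∀ τ ∈ Icc t0 t1, ∀ y, ‖y - (x0 + (τ - t0) • ((t1 - t0)⁻¹ • (x1 - x0)))‖ ≤ ρ →
      (y, τ) ∈ U ∧ 0 ≤ v y τ) →
    (∀ y, ‖y - x0‖ ≤ α * ρ → l ≤ v y t0) → l * α ^ γ ≤ v x1 t1 := by
  set κ0 : ℝ := 3 / 4 / τ1 with hκ0
  have hκ0p : 0 < κ0 := by positivity
  set C0 : ℝ := 4 * (n * θ⁻¹) + 4 * Lam + 2 / τ0 + 4 * (D / τ0) with hC0
  obtain ⟨k, hk⟩ : ∃ k : ℕ, (C0 + 8 * θ) ^ 2 ≤ 32 * θ * (k + 2) * κ0 := by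
    obtain ⟨k, hk⟩ := exists_nat_gt ((C0 + 8 * θ) ^ 2 / (32 * θ * κ0))
    refine ⟨k, ?_⟩
    rw [div_lt_iff₀ (by positivity)] at hk
    have : 0 < θ * κ0 := by positivity
    nlinarith
  refine ⟨2 * k, ?_⟩
  intro v U hv x0 x1 t0 t1 ρ α l hρ hρ1 hα hα1 hl hT0 hT1 hx01 htube hinit
  set T := t1 - t0 with hT
  have hTp : 0 < T := lt_of_lt_of_le (by positivity) hT0
  set ξ : Eu n := T⁻¹ • (x1 - x0) with hξ
  set κ : ℝ := (1 - α ^ 2) * ρ ^ 2 / T with hκ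
  have hα2 : α ^ 2 ≤ 1 / 4 := by nlinarith
  have hκκ : κ0 ≤ κ := by
    rw [hκ0, hκ, div_le_div_iff₀ hτ1 hTp]
    nlinarith [sq_nonneg ρ, sq_pos_of_pos hρ]
  have hκp : 0 < κ := hκ0p.trans_le hκκ
  have hκup : κ ≤ 1 / τ0 := by
    rw [hκ, div_le_div_iff₀ hTp hτ0]
    nlinarith [sq_nonneg α, sq_pos_of_pos hρ, mul_nonneg (sq_nonneg α) (sq_nonneg ρ)]
  have hξn : ‖ξ‖ * ρ ≤ D / τ0 := by
    rw [hξ, norm_smul, norm_inv, Real.norm_of_nonneg hTp.le, le_div_iff₀ hτ0]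
    have : T⁻¹ * ‖x1 - x0‖ * ρ * τ0 ≤ T⁻¹ * (D * ρ) * ρ * τ0 := by gcongr
    refine this.trans ?_
    have : T⁻¹ * (D * ρ) * ρ * τ0 = D * (τ0 * ρ ^ 2 / T) := by field_simp
    rw [this]
    have : τ0 * ρ ^ 2 / T ≤ 1 := by rw [div_le_one hTp]; exact hT0
    nlinarith
  set s : ℝ → ℝ := fun τ => α ^ 2 * ρ ^ 2 + κ * (τ - t0) with hs
  set X : ℝ → Eu n := fun τ => x0 + (τ - t0) • ξ with hX
  have hs1 : s t1 = ρ ^ 2 := by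
    simp only [hs, hκ, ← hT]; field_simp; ring
  have hX1 : X t1 = x1 := by
    simp only [hX, hξ, ← hT, smul_smul]
    rw [mul_inv_cancel₀ hTp.ne']; simp
  have hspos : ∀ τ, t0 ≤ τ → 0 < s τ := by
    intro τ hτ
    have : 0 ≤ κ * (τ - t0) := mul_nonneg hκp.le (by linarith)
    have : 0 < α ^ 2 * ρ ^ 2 := by positivity
    simp only [hs]; linarith
  have hsle : ∀ τ, τ ≤ t1 → s τ ≤ ρ ^ 2 := by
    intro τ hτ
    rw [← hs1]
    simp only [hs]
    have : κ * (τ - t0) ≤ κ * (t1 - t0) := by gcongr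
    linarith
  set c : ℝ := l * (α ^ 2 * ρ ^ 2) ^ k with hc
  have hcp : 0 < c := by positivity
  set W : Eu n → ℝ → ℝ := fun y τ => s τ - ‖y - X τ‖ ^ 2 with hW
  set ψ : Eu n → ℝ → ℝ := fun y τ => c * (W y τ ^ 2 / s τ ^ (k + 2)) with hψ
  have hψ1 : ψ x1 t1 = l * α ^ (2 * k) := by
    simp only [hψ, hW, hX1, hs1, hc]
    simp
    field_simp
    ring
  rw [← hψ1]
  by_contra hcon
  push Not at hcon
  set σ : ℝ := (ψ x1 t1 - v x1 t1) / (2 * T) with hσ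
  have hσp : 0 < σ := div_pos (by linarith) (by linarith)
  set f : Eu n × ℝ → ℝ := fun p => v p.1 p.2 - ψ p.1 p.2 + σ * (p.2 - t0) with hf
  set K : Set (Eu n × ℝ) := {p | p.2 ∈ Icc t0 t1 ∧ 0 ≤ W p.1 p.2} with hK
  have hsc : Continuous s := by simp only [hs]; fun_prop
  have hXc : Continuous X := by simp only [hX]; fun_prop
  have hWc : Continuous (fun p : Eu n × ℝ => W p.1 p.2) := by simp only [hW]; fun_prop
  have hKtube : ∀ p ∈ K, p ∈ U ∧ 0 ≤ v p.1 p.2 := by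
    rintro ⟨y, τ⟩ ⟨hτ, hw⟩
    refine htube τ hτ y ?_
    have h1 := hsle τ hτ.2
    simp only [hW] at hw
    exact abs_le_of_sq_le_sq' (by simpa only [hX] using (by linarith : ‖y - X τ‖ ^ 2 ≤ ρ ^ 2)) hρ.le |>.2
  have hKc : IsCompact K := by
    refine IsCompact.of_isClosed_subset
      ((isCompact_closedBall x0 (ρ + ‖T • ξ‖)).prod (isCompact_Icc (a := t0) (b := t1))) ?_ ?_
    · exact (isClosed_Icc.preimage continuous_snd).inter (isClosed_le continuous_const hWc)
    · rintro ⟨y, τ⟩ ⟨hτ, hw⟩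
      refine ⟨?_, hτ⟩
      have h1 := hsle τ hτ.2
      simp only [hW] at hw
      have h2 : ‖y - X τ‖ ≤ ρ := abs_le_of_sq_le_sq' (by linarith) hρ.le |>.2
      rw [mem_closedBall, dist_eq_norm]
      have : y - x0 = (y - X τ) + (τ - t0) • ξ := by simp only [hX]; abel
      show ‖y - x0‖ ≤ _
      rw [this]
      refine (norm_add_le _ _).trans (add_le_add h2 ?_)
      rw [norm_smul (τ - t0) ξ, norm_smul T ξ]
      refine mul_le_mul_of_nonneg_right ?_ (norm_nonneg ξ)
      rw [Real.norm_of_nonneg (by linarith [hτ.1]), Real.norm_of_nonneg hTp.le, hT]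
      linarith [hτ.2]
  have hfc : ContinuousOn f K := by
    simp only [hf]
    refine ContinuousOn.add (ContinuousOn.sub (hv.cont.mono fun p hp => (hKtube p hp).1) ?_) ?_
    · simp only [hψ]
      refine ContinuousOn.mul continuousOn_const (ContinuousOn.div (by fun_prop) (by fun_prop) ?_)
      intro p hp
      exact (pow_pos (hspos _ hp.1.1) _).ne'
    · fun_prop
  have hmem1 : (x1, t1) ∈ K := by
    refine ⟨⟨by simp only; linarith, le_rfl⟩, ?_⟩
    simp only [hW, hX1, hs1]; simp; positivity
  obtain ⟨⟨y, t⟩, hyK, hymin⟩ := hKc.exists_isMinOn ⟨_, hmem1⟩ hfc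
  have hmin : ∀ p ∈ K, f (y, t) ≤ f p := fun p hp => hymin hp
  have hf1 : f (x1, t1) < 0 := by
    simp only [hf, hσ, ← hT]
    have : (ψ x1 t1 - v x1 t1) / (2 * T) * T = (ψ x1 t1 - v x1 t1) / 2 := by field_simp
    rw [this]; linarith
  have hfy : f (y, t) < 0 := (hmin _ hmem1).trans_lt hf1
  obtain ⟨⟨htl, htu⟩, hwy⟩ := hyK
  simp only at htl htu hwy
  have hyU := hKtube (y, t) ⟨⟨htl, htu⟩, hwy⟩
  have hst := hspos t htl
  -- strict interior
  have hwpos : 0 < W y t := by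
    rcases hwy.lt_or_eq with h | h
    · exact h
    · exfalso
      have : f (y, t) = v y t + σ * (t - t0) := by
        simp only [hf, hψ, ← h]; simp
      have h3 : 0 ≤ σ * (t - t0) := mul_nonneg hσp.le (by linarith)
      have := hyU.2
      simp only at this
      linarith
  have htpos : t0 < t := by
    rcases htl.lt_or_eq with h | h
    · exact h
    · exfalso
      have hst0 : s t0 = α ^ 2 * ρ ^ 2 := by simp [hs]
      have hXt0 : X t0 = x0 := by simp [hX]
      have hw' : W y t0 ≤ α ^ 2 * ρ ^ 2 := by
        simp only [hW, hst0]; linarith [sq_nonneg ‖y - X t0‖]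
      have hin : l ≤ v y t0 := by
        apply hinit
        rw [← h] at hwpos
        simp only [hW, hst0, hXt0] at hwpos
        exact abs_le_of_sq_le_sq' (by rw [mul_pow]; linarith) (by positivity) |>.2
      have hψle : ψ y t0 ≤ l := by
        simp only [hψ, hst0, hc]
        have h5 : W y t0 ^ 2 ≤ (α ^ 2 * ρ ^ 2) ^ 2 := by
          rw [← h] at hwpos
          exact pow_le_pow_left₀ hwpos.le hw' 2
        have hA : 0 < α ^ 2 * ρ ^ 2 := by positivity
        calc l * (α ^ 2 * ρ ^ 2) ^ k * (W y t0 ^ 2 / (α ^ 2 * ρ ^ 2) ^ (k + 2))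
            ≤ l * (α ^ 2 * ρ ^ 2) ^ k * ((α ^ 2 * ρ ^ 2) ^ 2 / (α ^ 2 * ρ ^ 2) ^ (k + 2)) := by gcongr
          _ = l := by rw [pow_add]; field_simp
      simp only [hf, ← h] at hfy
      simp at hfy
      linarith
  set Z : Eu n := y - X t with hZ
  set C : ℝ := c / s t ^ (k + 2) with hC
  have hCp : 0 < C := by positivity
  have hwZ : W y t = s t - ‖Z‖ ^ 2 := rfl
  have hlines : ∀ p : Eu n, ∃ a0 a3 a4 : ℝ, IsLocalMin (fun τ : ℝ => v (y + τ • p) t -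
      (a0 + ((-4 * W y t * C) * inner ℝ Z p) * τ +
        ((4 * C) * (inner ℝ Z p) ^ 2 + (-2 * W y t * C) * ‖p‖ ^ 2) * τ ^ 2
        + a3 * τ ^ 3 + a4 * τ ^ 4)) 0 := by
    intro p
    refine ⟨C * W y t ^ 2, 4 * C * inner ℝ Z p * ‖p‖ ^ 2, C * ‖p‖ ^ 4, ?_⟩
    have hexp : ∀ τ : ℝ, W (y + τ • p) t = W y t - 2 * τ * inner ℝ Z p - τ ^ 2 * ‖p‖ ^ 2 := by
      intro τ
      have : y + τ • p - X t = Z + τ • p := by rw [hZ]; abel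
      simp only [hW, this]
      rw [norm_add_sq_real, real_inner_smul_right, norm_smul, mul_pow, Real.norm_eq_abs, sq_abs]
      ring
    have hψe : ∀ τ : ℝ, ψ (y + τ • p) t = C * W y t ^ 2 + ((-4 * W y t * C) * inner ℝ Z p) * τ +
        ((4 * C) * (inner ℝ Z p) ^ 2 + (-2 * W y t * C) * ‖p‖ ^ 2) * τ ^ 2
        + (4 * C * inner ℝ Z p * ‖p‖ ^ 2) * τ ^ 3 + (C * ‖p‖ ^ 4) * τ ^ 4 := by
      intro τ
      simp only [hψ, hexp, hC]
      ring
    have hev : ∀ᶠ τ : ℝ in 𝓝 0, 0 < W (y + τ • p) t := by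
      have hcont : Continuous fun τ : ℝ => W (y + τ • p) t := by
        simp only [hexp]; fun_prop
      have := hcont.tendsto 0
      simp only [zero_smul, add_zero] at this
      exact this.eventually (lt_mem_nhds hwpos)
    filter_upwards [hev] with τ hτ
    have h1 := hmin (y + τ • p, t) ⟨⟨htl, htu⟩, hτ.le⟩
    simp only [hf] at h1
    rw [← hψe, ← hψe]
    simp only [zero_smul, add_zero]
    linarith
  obtain ⟨hg, hh⟩ := ks_space_test hv hyU.1 Z _ _ _ hlines
  have hlow := ks_time_lower hθ hv hyU.1 Z _ _ _ (by positivity)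
    (by have := mul_pos hwpos hCp; linarith) hg hh
  -- time derivative
  have hsd : HasDerivAt s κ t := by
    have := (((hasDerivAt_id t).sub_const t0).const_mul κ).const_add (α ^ 2 * ρ ^ 2)
    rw [mul_one] at this
    exact this
  have hXd : HasDerivAt (fun τ => y - X τ) (-ξ) t := by
    have := ((((hasDerivAt_id t).sub_const t0).smul_const ξ).const_add x0).const_sub y
    simpa using this
  have hWd : HasDerivAt (fun τ => W y τ) (κ + 2 * inner ℝ Z ξ) t := by
    have := hsd.sub hXd.norm_sq
    refine this.congr_deriv ?_
    simp [hZ]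
  have hψd : HasDerivAt (fun τ => ψ y τ)
      (C * (-(k + 2) * κ * W y t ^ 2 / s t + 2 * W y t * (κ + 2 * inner ℝ Z ξ))) t := by
    have h1 := ((hWd.pow 2).div (hsd.pow (k + 2)) (pow_pos hst _).ne').const_mul c
    refine h1.congr_deriv ?_
    simp only [hC, Pi.pow_apply]
    push_cast
    have e1 : s t ^ (k + 1) = s t ^ k * s t := pow_succ _ _
    rw [e1]
    have e2 : s t ^ (k + 2) = s t ^ k * s t ^ 2 := by rw [pow_add]
    rw [e2]
    have : 0 < s t ^ k := pow_pos hst _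
    field_simp
    ring
  have hvd := hv.dt y t hyU.1
  have hfd : HasDerivAt (fun τ => v y τ - ψ y τ + σ * (τ - t0)) (tD v y t -
      (C * (-(k + 2) * κ * W y t ^ 2 / s t + 2 * W y t * (κ + 2 * inner ℝ Z ξ))) + σ) t := by
    have h1 := (hvd.hasDerivAt.sub hψd).add (((hasDerivAt_id t).sub_const t0).const_mul σ)
    refine h1.congr_deriv ?_
    simp [tD]
  have hle := ks_left_deriv hfd.differentiableAt (by
    have hcont : Continuous fun τ : ℝ => W y τ := hWc.comp (by fun_prop : Continuous fun τ : ℝ => (y, τ))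
    have e1 : ∀ᶠ τ in 𝓝[<] t, 0 < W y τ :=
      (hcont.tendsto t).mono_left nhdsWithin_le_nhds |>.eventually (lt_mem_nhds hwpos)
    have e2 : ∀ᶠ τ in 𝓝[<] t, t0 < τ := (lt_mem_nhds htpos).filter_mono nhdsWithin_le_nhds
    filter_upwards [e1, e2, self_mem_nhdsWithin] with τ h1 h2 h3
    exact hmin (y, τ) ⟨⟨h2.le, (le_of_lt h3).trans htu⟩, h1.le⟩)
  rw [hfd.deriv] at hle
  have hZρ : ‖Z‖ ≤ ρ := by
    have := hsle t htu
    exact abs_le_of_sq_le_sq' (by linarith) hρ.le |>.2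
  have hin : inner ℝ Z ξ ≤ D / τ0 := by
    refine (real_inner_le_norm Z ξ).trans ?_
    calc ‖Z‖ * ‖ξ‖ ≤ ρ * ‖ξ‖ := by gcongr
      _ ≤ _ := by rw [mul_comm]; exact hξn
  have halg := ks_barrier_alg (w := W y t) hθ hκκ hst hk
  have hC0w : W y t * (4 * (n * θ⁻¹) + 4 * Lam * ‖Z‖ + 2 * κ + 4 * inner ℝ Z ξ) ≤ C0 * W y t := by
    rw [mul_comm C0]
    have : Lam * ‖Z‖ ≤ Lam := by
      calc Lam * ‖Z‖ ≤ Lam * 1 := by gcongr; linarith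
        _ = Lam := mul_one _
    have h2 : 2 * κ ≤ 2 / τ0 := by
      have : (2:ℝ) / τ0 = 2 * (1 / τ0) := by ring
      linarith
    gcongr
    rw [hC0]
    linarith
  have habs : |-4 * W y t * C| = 4 * W y t * C := by
    rw [show -4 * W y t * C = -(4 * W y t * C) by ring, abs_neg, abs_of_pos (by positivity)]
  rw [habs] at hlow
  have hfin : 0 ≤ C * (8 * θ * (s t - W y t) + (k + 2) * κ * W y t ^ 2 / s t -
      W y t * (4 * (n * θ⁻¹) + 4 * Lam * ‖Z‖ + 2 * κ + 4 * inner ℝ Z ξ)) :=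
    mul_nonneg hCp.le (by linarith)
  have hZ2 : ‖Z‖ ^ 2 = s t - W y t := by rw [hwZ]; ring
  rw [hZ2] at hlow
  have e : C * (-(k + 2) * κ * W y t ^ 2 / s t + 2 * W y t * (κ + 2 * inner ℝ Z ξ)) =
    - (C * ((k + 2) * κ * W y t ^ 2 / s t)) + C * (2 * W y t * (κ + 2 * inner ℝ Z ξ)) := by ring
  rw [e] at hle
  linarith

lemma KSol.const_sub {θ Lam : ℝ} {v : Eu n → ℝ → ℝ} {U : Set (Eu n × ℝ)} (hv : KSol θ Lam v U)
    (c : ℝ) : KSol θ Lam (fun x t => c - v x t) U := by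
  have e1 : ∀ x t, tD (fun x t => c - v x t) x t = - tD v x t := by
    intro x t
    simp only [tD]
    exact deriv_const_sub c
  have e2 : ∀ x t, sG (fun x t => c - v x t) x t = - sG v x t := by
    intro x t
    simp only [sG, gradient]
    rw [show (fun y => c - v y t) = (fun y => c - (fun y => v y t) y) from rfl, fderiv_const_sub]
    simp
  have e3 : ∀ x t, sH (fun x t => c - v x t) x t = (-1 : ℝ) • sH v x t := by
    intro x t
    ext i j
    simp only [sH, e2, Matrix.smul_apply, PiLp.neg_apply]
    rw [fderiv_fun_neg]
    simp
  refine ⟨hv.isOpen, continuousOn_const.sub hv.cont, fun x t h => contDiffAt_const.sub (hv.cd x t h),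
    fun x t h => (hv.dt x t h).const_sub c, ?_, ?_⟩
  · simp only [e1]
    exact hv.contT.neg
  · intro x t h
    obtain ⟨A, β, hA, hβ, he⟩ := hv.eqn x t h
    refine ⟨A, β, hA, hβ, ?_⟩
    rw [e1, e2, e3, ks_trMul_smul, he, ks_dotp_eq, ks_dotp_eq, inner_neg_right]
    ring

open MeasureTheory in
/-- Images under locally Lipschitz functions. -/
lemma ks_image_measure {T : Set ℝ} (f : ℝ → ℝ) (C : NNReal) {η : ℝ} (hη : 0 < η)
    (hT : MeasurableSet T)
    (h : ∀ s ∈ T, ∀ t ∈ T, |s - t| < η → |f s - f t| ≤ C * |s - t|) :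
    volume (f '' T) ≤ C * volume T := by
  set I : ℤ → Set ℝ := fun k => Ico (k • η) ((k + 1) • η) with hI
  have hdis : Pairwise (Function.onFun Disjoint fun k => T ∩ I k) := by
    intro i j hij
    exact (pairwise_disjoint_Ico_zsmul η hij).mono inter_subset_right inter_subset_right
  have hcov : T = ⋃ k, T ∩ I k := by
    rw [← inter_iUnion, hI, iUnion_Ico_zsmul hη, inter_univ]
  have hl : ∀ k, volume (f '' (T ∩ I k)) ≤ C * volume (T ∩ I k) := by
    intro k
    have hlip : LipschitzOnWith C f (T ∩ I k) := by
      refine LipschitzOnWith.of_dist_le_mul fun s hs t ht => ?_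
      rw [Real.dist_eq, Real.dist_eq]
      refine h s hs.1 t ht.1 ?_
      have h1 := hs.2.1
      have h2 := hs.2.2
      have h3 := ht.2.1
      have h4 := ht.2.2
      rw [add_smul, one_smul] at h2 h4
      rw [abs_lt]; constructor <;> linarith
    have := hlip.hausdorffMeasure_image_le (d := 1) zero_le_one
    rw [hausdorffMeasure_real] at this
    simpa using this
  calc volume (f '' T) = volume (⋃ k, f '' (T ∩ I k)) := by rw [← image_iUnion, ← hcov]
    _ ≤ ∑' k, volume (f '' (T ∩ I k)) := measure_iUnion_le _
    _ ≤ ∑' k, C * volume (T ∩ I k) := ENNReal.tsum_le_tsum hl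
    _ = C * ∑' k, volume (T ∩ I k) := ENNReal.tsum_mul_left
    _ = C * volume (⋃ k, T ∩ I k) := by
      rw [measure_iUnion hdis fun k => hT.inter measurableSet_Ico]
    _ = C * volume T := by rw [← hcov]

/-- Information at a contact point from below with a paraboloid. -/
lemma ks_contact {θ Lam : ℝ} (hθ : 0 < θ) (hLam : 0 ≤ Lam) {v : Eu n → ℝ → ℝ}
    {U : Set (Eu n × ℝ)} (hv : KSol θ Lam v U) {x0 x y : Eu n} {a t r K : ℝ} (hr : 0 < r) (hr1 : r ≤ 1)
    (hK : 0 < K) (hxt : (x, t) ∈ U) (hx : x ∈ ball x0 r) (hat : a < t) (hxy : ‖x - y‖ ≤ 2 * r)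
    (hmin : ∀ x' ∈ closedBall x0 r, ∀ s ∈ Icc a t,
      v x t + K * ‖x - y‖ ^ 2 - K / 2 * t ≤ v x' s + K * ‖x' - y‖ ^ 2 - K / 2 * s) :
    y = x + (2 * K)⁻¹ • sG v x t ∧ - (2 * K * (n * θ⁻¹ + 2 * Lam)) ≤ tD v x t ∧
    |(1 + (2 * K)⁻¹ • sH v x t).det| ≤ (θ⁻¹ * (n * θ⁻¹ + 1 / 4 + 2 * Lam)) ^ n := by
  have hlines : ∀ p : Eu n, ∃ a0 a3 a4 : ℝ, IsLocalMin (fun τ : ℝ => v (x + τ • p) t -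
      (a0 + ((-2 * K) * inner ℝ (x - y) p) * τ +
        (0 * (inner ℝ (x - y) p) ^ 2 + (-K) * ‖p‖ ^ 2) * τ ^ 2
        + a3 * τ ^ 3 + a4 * τ ^ 4)) 0 := by
    intro p
    refine ⟨0, 0, 0, ?_⟩
    have hev : ∀ᶠ τ : ℝ in 𝓝 0, x + τ • p ∈ ball x0 r := by
      have hcont : Continuous fun τ : ℝ => x + τ • p := by fun_prop
      have := hcont.tendsto 0
      simp only [zero_smul, add_zero] at this
      exact this.eventually (isOpen_ball.mem_nhds hx)
    filter_upwards [hev] with τ hτ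
    have h1 := hmin (x + τ • p) (ball_subset_closedBall hτ) t ⟨hat.le, le_rfl⟩
    have : ‖x + τ • p - y‖ ^ 2 = ‖x - y‖ ^ 2 + 2 * τ * inner ℝ (x - y) p + τ ^ 2 * ‖p‖ ^ 2 := by
      rw [show x + τ • p - y = (x - y) + τ • p by abel, norm_add_sq_real, real_inner_smul_right,
        norm_smul, mul_pow, Real.norm_eq_abs, sq_abs]
      ring
    rw [this] at h1
    simp only [zero_smul, add_zero]
    linarith
  obtain ⟨hg, hh⟩ := ks_space_test hv hxt (x - y) _ _ _ hlines
  have hlow := ks_time_lower hθ hv hxt (x - y) _ _ _ le_rfl (by linarith) hg hh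
  have habs : |-2 * K| = 2 * K := by
    rw [show -2 * K = -(2 * K) by ring, abs_neg, abs_of_pos (by positivity)]
  have hvd := hv.dt x t hxt
  have hup : tD v x t ≤ K / 2 := by
    have hd : HasDerivAt (fun s => v x s - K / 2 * s) (tD v x t - K / 2) t := by
      have := hvd.hasDerivAt.sub ((hasDerivAt_id t).const_mul (K / 2))
      rw [mul_one] at this
      exact this
    have := ks_left_deriv hd.differentiableAt (by
      have e2 : ∀ᶠ τ in 𝓝[<] t, a < τ := (lt_mem_nhds hat).filter_mono nhdsWithin_le_nhds
      filter_upwards [e2, self_mem_nhdsWithin] with τ h2 h3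
      have := hmin x (ball_subset_closedBall hx) τ ⟨h2.le, le_of_lt h3⟩
      linarith)
    rw [hd.deriv] at this
    linarith
  have hLr : Lam * ‖x - y‖ ≤ Lam * 2 := by gcongr; linarith
  refine ⟨?_, ?_, ?_⟩
  · rw [hg, smul_smul, show (2 * K)⁻¹ * (-2 * K) = -1 by field_simp]
    simp
  · rw [habs] at hlow
    nlinarith
  · have hcd := hv.cd x t hxt
    have hsym : (1 + (2 * K)⁻¹ • sH v x t).IsSymm := by
      refine Matrix.IsSymm.ext fun i j => ?_
      simp only [Matrix.add_apply, Matrix.smul_apply]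
      rw [show sH v x t j i = sH v x t i j from (ks_hess_symm hcd i j).symm, Matrix.one_apply,
        Matrix.one_apply]
      simp [eq_comm]
    have hpsd : ∀ p, 0 ≤ mquad (1 + (2 * K)⁻¹ • sH v x t) p := by
      intro p
      have h1 := hh p
      rw [ks_mquad_add, ks_mquad_smul]
      have h2 := ks_mquad_one 1 p
      rw [one_smul] at h2
      rw [h2]
      have h3 : (2 * K)⁻¹ * (2 * (0 * (inner ℝ (x - y) p) ^ 2 + (-K) * ‖p‖ ^ 2)) ≤
        (2 * K)⁻¹ * mquad (sH v x t) p := by gcongr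
      have h4 : (2 * K)⁻¹ * (2 * (0 * (inner ℝ (x - y) p) ^ 2 + (-K) * ‖p‖ ^ 2)) = - ‖p‖ ^ 2 := by
        field_simp; ring
      linarith
    refine ks_det_bound hsym hpsd ?_
    obtain ⟨A, β, hA, hβ, he⟩ := hv.eqn x t hxt
    have h1 := ks_trace_lower hA (M := 1 + (2 * K)⁻¹ • sH v x t) hpsd
    rw [ks_trMul_add, ks_trMul_smul, ks_trMul_one] at h1
    have h2 := ks_trace_upper hA
    have h3 : trMul A (sH v x t) ≤ K / 2 + Lam * (2 * K) * 2 := by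
      have h4 : -(Lam * (2 * K) * 2) ≤ dotp β (sG v x t) := by
        rw [ks_dotp_eq, hg, real_inner_smul_right]
        have h5 := abs_real_inner_le_norm β (x - y)
        have h6 : |-2 * K * inner ℝ β (x - y)| ≤ (2 * K) * (Lam * 2) := by
          rw [abs_mul, habs]
          gcongr
          refine h5.trans ?_
          exact mul_le_mul hβ (by linarith) (norm_nonneg _) hLam
        have h7 := neg_abs_le (-2 * K * inner ℝ β (x - y))
        linarith
      linarith
    have h4 : (2 * K)⁻¹ * trMul A (sH v x t) ≤ (2 * K)⁻¹ * (K / 2 + Lam * (2 * K) * 2) := by gcongr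
    have h5 : (2 * K)⁻¹ * (K / 2 + Lam * (2 * K) * 2) = 1 / 4 + 2 * Lam := by field_simp; ring
    rw [inv_mul_eq_div, le_div_iff₀ hθ]
    linarith

/-- Determinant of the derivative of the contact map. -/
lemma ks_contact_map {f : Eu n → ℝ} {x : Eu n} (hf : ContDiffAt ℝ 2 f x) (k : ℝ) :
    DifferentiableAt ℝ (fun z => z + k • gradient f z) x ∧
    (fderiv ℝ (fun z => z + k • gradient f z) x).det = (1 + k • hessS f x).det := by
  have hd : DifferentiableAt ℝ (gradient f) x :=
    (ks_grad_diff hf).differentiableAt (by norm_num)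
  have h1 : HasFDerivAt (fun z => z + k • gradient f z)
      (ContinuousLinearMap.id ℝ (Eu n) + k • fderiv ℝ (gradient f) x) x :=
    (hasFDerivAt_id x).add (hd.hasFDerivAt.const_smul k)
  refine ⟨h1.differentiableAt, ?_⟩
  rw [h1.fderiv, ContinuousLinearMap.det,
    ← LinearMap.det_toMatrix (EuclideanSpace.basisFun (Fin n) ℝ).toBasis]
  congr 1
  ext i j
  rw [LinearMap.toMatrix_apply]
  simp only [OrthonormalBasis.coe_toBasis, OrthonormalBasis.coe_toBasis_repr_apply,
    EuclideanSpace.basisFun_apply, EuclideanSpace.basisFun_repr, Matrix.add_apply, Matrix.smul_apply,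
    ks_hess_apply hf]
  simp [Matrix.one_apply, Pi.single_apply]

lemma ks_first_contact {B : Set (Eu n)} (hB : IsCompact B) {a t0 h : ℝ}
    (φ : Eu n × ℝ → ℝ) (hφ : Continuous φ) (hat : a ≤ t0) (hlow : ∃ x ∈ B, φ (x, t0) ≤ h)
    (hbot : ∀ x ∈ B, h < φ (x, a)) :
    ∃ x ∈ B, ∃ t ∈ Icc a t0, φ (x, t) = h ∧ ∀ x' ∈ B, ∀ s ∈ Icc a t, h ≤ φ (x', s) := by
  set S : Set (Eu n × ℝ) := (B ×ˢ Icc a t0) ∩ {p | φ p ≤ h} with hS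
  have hSc : IsCompact S := (hB.prod isCompact_Icc).inter_right (isClosed_le hφ continuous_const)
  obtain ⟨x1, hx1, hx1'⟩ := hlow
  have hne : S.Nonempty := ⟨(x1, t0), ⟨hx1, ⟨hat, le_rfl⟩⟩, hx1'⟩
  obtain ⟨⟨x, t⟩, hxt, hmin⟩ := hSc.exists_isMinOn hne continuous_snd.continuousOn
  have hmin' : ∀ p ∈ S, t ≤ p.2 := fun p hp => hmin hp
  obtain ⟨⟨hx, ht⟩, hle⟩ := hxt
  simp only at hx ht
  have key : ∀ x' ∈ B, h ≤ φ (x', t) := by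
    intro x' hx'
    by_contra hcon
    push Not at hcon
    have hta : a < t := by
      rcases ht.1.lt_or_eq with h1 | h1
      · exact h1
      · have := hbot x' hx'
        rw [h1] at this; linarith
    have hc : Continuous fun s : ℝ => φ (x', s) := hφ.comp (by fun_prop)
    have e1 : ∀ᶠ s in 𝓝[<] t, φ (x', s) < h :=
      ((hc.tendsto t).eventually (gt_mem_nhds hcon)).filter_mono nhdsWithin_le_nhds
    have e2 : ∀ᶠ s in 𝓝[<] t, a < s := (lt_mem_nhds hta).filter_mono nhdsWithin_le_nhds
    obtain ⟨s, h1, h2, h3⟩ := (e1.and (e2.and self_mem_nhdsWithin)).exists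
    have h3' : s < t := h3
    have := hmin' (x', s) ⟨⟨hx', ⟨h2.le, h3'.le.trans ht.2⟩⟩, h1.le⟩
    simp only at this
    linarith
  refine ⟨x, hx, t, ht, le_antisymm hle (key x hx), fun x' hx' s hs => ?_⟩
  rcases hs.2.lt_or_eq with h1 | h1
  · by_contra hcon
    push Not at hcon
    have := hmin' (x', s) ⟨⟨hx', ⟨hs.1, hs.2.trans ht.2⟩⟩, hcon.le⟩
    simp only at this
    linarith
  · rw [h1]; exact key x' hx'

open MeasureTheory in
set_option maxHeartbeats 1600000 in
/-- Core of the measure to point estimate. -/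
lemma ks_ABP {θ Lam : ℝ} (hθ : 0 < θ) (hLam : 0 ≤ Lam) {v : Eu n → ℝ → ℝ}
    {U : Set (Eu n × ℝ)} (hv : KSol θ Lam v U) {x0 : Eu n} {t0 r l : ℝ} (hr : 0 < r) (hr1 : r ≤ 1)
    (hl : 0 < l) (hsub : closedBall x0 r ×ˢ Icc (t0 - r ^ 2) t0 ⊆ U)
    (hpos : ∀ x ∈ closedBall x0 r, ∀ t ∈ Icc (t0 - r ^ 2) t0, 0 ≤ v x t)
    (hcon : v x0 t0 < l / 2) :
    volume (closedBall x0 (r / 4)) * ENNReal.ofReal (r ^ 2 / (4 * (4 * (n * θ⁻¹ + 2 * Lam) + 2))) ≤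
      ENNReal.ofReal ((θ⁻¹ * (n * θ⁻¹ + 1 / 4 + 2 * Lam)) ^ n) *
        volume {p : Eu n × ℝ | p ∈ closedBall x0 r ×ˢ Icc (t0 - r ^ 2) t0 ∧ v p.1 p.2 < l} := by
  set a := t0 - r ^ 2 with ha
  set B := closedBall x0 r with hB
  set K : ℝ := 2 * l / r ^ 2 with hK
  have hKp : 0 < K := by positivity
  have hKr : K * r ^ 2 = 2 * l := by rw [hK]; field_simp
  have hat0 : a ≤ t0 := by rw [ha]; nlinarith
  have hBc : IsCompact B := isCompact_closedBall _ _
  set Cy : Set (Eu n × ℝ) := B ×ˢ Icc a t0 with hCy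
  have hCyc : IsCompact Cy := hBc.prod isCompact_Icc
  -- continuous extension
  obtain ⟨g, hg⟩ := ContinuousMap.exists_restrict_eq hCyc.isClosed
    ⟨Cy.domRestrict fun p : Eu n × ℝ => v p.1 p.2, (hv.cont.mono hsub).domRestrict⟩
  have hgv : ∀ x ∈ B, ∀ t ∈ Icc a t0, g (x, t) = v x t := by
    intro x hx t ht
    have := congrArg (fun F => F ⟨(x, t), ⟨hx, ht⟩⟩) hg
    exact this
  set φ : Eu n → Eu n × ℝ → ℝ := fun y p => g p + K * ‖p.1 - y‖ ^ 2 + K / 2 * (t0 - p.2) with hφ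
  have hφc : Continuous fun q : Eu n × (Eu n × ℝ) => φ q.1 q.2 := by
    simp only [hφ]; fun_prop
  set h1 : ℝ := 11 / 16 * l with hh1
  set h2 : ℝ := 15 / 16 * l with hh2
  set Y : Set (Eu n) := closedBall x0 (r / 4) with hY
  -- closed set of contact configurations
  set Z : Set (Eu n × (Eu n × ℝ)) := (B ×ˢ (Y ×ˢ Icc a t0)) ∩
    ({q | φ q.2.1 (q.1, q.2.2) ∈ Icc h1 h2} ∩ (⋂ σ ∈ Icc (0:ℝ) 1, ⋂ x' ∈ B,
      {q | φ q.2.1 (q.1, q.2.2) ≤ φ q.2.1 (x', a + σ * (q.2.2 - a))})) with hZ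
  have hφc1 : Continuous fun q : Eu n × (Eu n × ℝ) => φ q.2.1 (q.1, q.2.2) :=
    hφc.comp (by fun_prop : Continuous fun q : Eu n × (Eu n × ℝ) => (q.2.1, (q.1, q.2.2)))
  have hZc : IsCompact Z := by
    refine (hBc.prod ((isCompact_closedBall _ _).prod isCompact_Icc)).inter_right ?_
    refine (isClosed_Icc.preimage hφc1).inter ?_
    refine isClosed_biInter fun σ _ => isClosed_biInter fun x' _ => isClosed_le hφc1 ?_
    exact hφc.comp (by fun_prop :
      Continuous fun q : Eu n × (Eu n × ℝ) => (q.2.1, (x', a + σ * (q.2.2 - a))))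
  set T : Set (Eu n × ℝ) := Prod.snd '' Z with hT
  have hTc : IsCompact T := hZc.image continuous_snd
  have hTm : MeasurableSet T := hTc.measurableSet
  -- unpack
  have hZmem : ∀ x y t, (x, (y, t)) ∈ Z ↔ x ∈ B ∧ y ∈ Y ∧ t ∈ Icc a t0 ∧ φ y (x, t) ∈ Icc h1 h2 ∧
      ∀ x' ∈ B, ∀ s ∈ Icc a t, φ y (x, t) ≤ φ y (x', s) := by
    intro x y t
    constructor
    · rintro ⟨⟨hx, hy, ht⟩, hh, hall⟩
      refine ⟨hx, hy, ht, hh, fun x' hx' s hs => ?_⟩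
      simp only [mem_iInter] at hall
      rcases (hs.1.trans hs.2).lt_or_eq with h3 | h3
      · have h4 := hall ((s - a) / (t - a)) ⟨div_nonneg (by linarith [hs.1]) (by linarith),
          by rw [div_le_one (by linarith)]; linarith [hs.2]⟩ x' hx'
        have h5 : a + (s - a) / (t - a) * (t - a) = s := by
          rw [div_mul_cancel₀ _ (by linarith)]; ring
        simp only [mem_ofPred_eq, h5] at h4
        exact h4
      · have h4 := hall 0 ⟨le_rfl, zero_le_one⟩ x' hx'
        have h5 : s = a := le_antisymm (hs.2.trans h3.symm.le) hs.1
        simp only [mem_ofPred_eq, zero_mul, add_zero] at h4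
        rw [h5]; exact h4
    · rintro ⟨hx, hy, ht, hh, hall⟩
      refine ⟨⟨hx, hy, ht⟩, hh, ?_⟩
      simp only [mem_iInter]
      intro σ hσ x' hx'
      have := ht.1
      refine hall x' hx' _ ⟨?_, ?_⟩
      · have := mul_nonneg hσ.1 (by linarith : 0 ≤ t - a)
        linarith
      · have := mul_le_mul_of_nonneg_right hσ.2 (by linarith : 0 ≤ t - a)
        linarith
  have hx0B : x0 ∈ B := mem_closedBall_self hr.le
  have hbot : ∀ y, ∀ x ∈ B, h2 < φ y (x, a) := by
    intro y x hx
    have h3 := hpos x hx a ⟨le_rfl, hat0⟩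
    simp only [hφ, hgv x hx a ⟨le_rfl, hat0⟩]
    have h4 : 0 ≤ K * ‖x - y‖ ^ 2 := by positivity
    have h5 : K / 2 * (t0 - a) = l := by rw [ha]; linarith
    rw [h5, hh2]; linarith
  -- facts at contact points
  have hfacts : ∀ x y t, (x, (y, t)) ∈ Z → x ∈ ball x0 r ∧ a < t ∧ v x t < l ∧
      y = x + (2 * K)⁻¹ • sG v x t ∧ - (2 * K * (n * θ⁻¹ + 2 * Lam)) ≤ tD v x t ∧
      |(1 + (2 * K)⁻¹ • sH v x t).det| ≤ (θ⁻¹ * (n * θ⁻¹ + 1 / 4 + 2 * Lam)) ^ n := by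
    intro x y t hxyt
    obtain ⟨hx, hy, ht, hh, hall⟩ := (hZmem x y t).1 hxyt
    have hxn : ‖x - x0‖ ≤ r := by rw [← dist_eq_norm]; exact hx
    have hyn : ‖y - x0‖ ≤ r / 4 := by rw [← dist_eq_norm]; exact hy
    have hvx := hpos x hx t ht
    have hle := hh.2
    simp only [hφ, hgv x hx t ht] at hle
    have h4 : 0 ≤ K * ‖x - y‖ ^ 2 := by positivity
    have h5 : 0 ≤ K / 2 * (t0 - t) := mul_nonneg (by positivity) (by linarith [ht.2])
    have hat : a < t := by
      rcases ht.1.lt_or_eq with h3 | h3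
      · exact h3
      · have := hbot y x hx
        have h6 := hh.2
        rw [← h3] at h6; linarith
    have hxb : x ∈ ball x0 r := by
      rw [mem_ball, dist_eq_norm]
      rcases hxn.lt_or_eq with h3 | h3
      · exact h3
      · exfalso
        have h6 : 3 / 4 * r ≤ ‖x - y‖ := by
          have := norm_sub_le_norm_sub_add_norm_sub x y x0
          linarith
        have h7 : (3 / 4 * r) ^ 2 ≤ ‖x - y‖ ^ 2 := by gcongr
        have h8 : K * (3 / 4 * r) ^ 2 ≤ K * ‖x - y‖ ^ 2 := by gcongr
        have h9 : K * (3 / 4 * r) ^ 2 = 9 / 16 * (2 * l) := by rw [← hKr]; ring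
        rw [hh2] at hle
        linarith
    refine ⟨hxb, hat, by rw [hh2] at hle; linarith, ?_⟩
    refine ks_contact hθ hLam hv hr hr1 hKp (hsub ⟨hx, ht⟩) hxb hat ?_ ?_
    · have := norm_sub_le_norm_sub_add_norm_sub x x0 y
      rw [norm_sub_rev x0 y] at this
      linarith
    · intro x' hx' s hs
      have h6 := hall x' hx' s hs
      simp only [hφ, hgv x hx t ht, hgv x' hx' s ⟨hs.1, hs.2.trans ht.2⟩] at h6
      linarith
  -- lower bound on sections in time
  have hsec : ∀ y ∈ Y, ENNReal.ofReal (r ^ 2 / (4 * (4 * (n * θ⁻¹ + 2 * Lam) + 2))) ≤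
      volume (Prod.mk y ⁻¹' T) := by
    intro y hy
    have hyn : ‖y - x0‖ ≤ r / 4 := by rw [← dist_eq_norm]; exact hy
    set Ty := Prod.mk y ⁻¹' T with hTy
    have hTym : MeasurableSet Ty := measurable_prodMk_left hTm
    have hex : ∀ t ∈ Ty, ∃ x, (x, (y, t)) ∈ Z := by
      rintro t ⟨⟨x, y', t'⟩, hq, hq'⟩
      simp only [Prod.mk.injEq] at hq'
      rw [hq'.1, hq'.2] at hq
      exact ⟨x, hq⟩
    choose! xc hxc using hex
    set f : ℝ → ℝ := fun t => φ y (xc t, t) with hf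
    have hsurj : Icc h1 h2 ⊆ f '' Ty := by
      intro h hh
      obtain ⟨x, hx, t, ht, hφh, hall⟩ := ks_first_contact hBc (φ y)
        (hφc.comp (by fun_prop : Continuous fun p : Eu n × ℝ => (y, p))) (h := h) hat0
        ⟨x0, hx0B, by
          simp only [hφ, hgv x0 hx0B t0 ⟨hat0, le_rfl⟩]
          have h3 : ‖x0 - y‖ ≤ r / 4 := by rw [norm_sub_rev]; exact hyn
          have h4 : ‖x0 - y‖ ^ 2 ≤ (r / 4) ^ 2 := by gcongr
          have h5 : K * ‖x0 - y‖ ^ 2 ≤ K * (r / 4) ^ 2 := by gcongr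
          have h6 : K * (r / 4) ^ 2 = 2 * l / 16 := by rw [← hKr]; ring
          have h7 := hh.1
          rw [hh1] at h7
          simp only [sub_self, mul_zero, add_zero]
          linarith⟩
        (fun x hx => hh.2.trans_lt (hbot y x hx))
      have hmem : (x, (y, t)) ∈ Z := by
        rw [hZmem, hφh]
        exact ⟨hx, hy, ht, hh, hall⟩
      have htT : t ∈ Ty := ⟨_, hmem, rfl⟩
      refine ⟨t, htT, ?_⟩
      obtain ⟨hx2, -, -, -, hall2⟩ := (hZmem _ _ _).1 (hxc t htT)
      refine le_antisymm ?_ (hall _ hx2 t ⟨ht.1, le_rfl⟩)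
      rw [← hφh]
      exact hall2 x hx t ⟨ht.1, le_rfl⟩
    have hunif := hCyc.uniformContinuousOn_of_continuous (hv.contT.mono hsub)
    rw [Metric.uniformContinuousOn_iff] at hunif
    obtain ⟨η, hη, hun⟩ := hunif (K / 2) (by positivity)
    have hn0 : 0 ≤ n * θ⁻¹ := by positivity
    set C1 : ℝ := 2 * K * (n * θ⁻¹ + 2 * Lam) + K with hC1
    have hC1p : 0 < C1 := by positivity
    have hlip1 : ∀ s ∈ Ty, ∀ t ∈ Ty, s < t → |s - t| < η → |f s - f t| ≤ C1 * |s - t| := by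
      intro s hs t ht hst hd
      obtain ⟨hxs, -, hsI, -, halls⟩ := (hZmem _ _ _).1 (hxc s hs)
      obtain ⟨hxt, -, htI, -, hallt⟩ := (hZmem _ _ _).1 (hxc t ht)
      obtain ⟨-, -, -, -, hlow, -⟩ := hfacts _ _ _ (hxc t ht)
      have h3 : f t ≤ f s := hallt _ hxs s ⟨hsI.1, hst.le⟩
      have h4 : f s ≤ φ y (xc t, s) := halls _ hxt s ⟨hsI.1, le_rfl⟩
      have hIn : ∀ ζ ∈ Icc s t, ζ ∈ Icc a t0 := fun ζ hζ => ⟨hsI.1.trans hζ.1, hζ.2.trans htI.2⟩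
      obtain ⟨ζ, hζ, hmv⟩ := exists_deriv_eq_slope (v (xc t)) hst
        (fun ζ hζ => (hv.dt _ _ (hsub ⟨hxt, hIn ζ hζ⟩)).continuousAt.continuousWithinAt)
        (fun ζ hζ => (hv.dt _ _ (hsub ⟨hxt, hIn ζ (Ioo_subset_Icc_self hζ)⟩)).differentiableWithinAt)
      have h5 := hun (xc t, ζ) ⟨hxt, hIn ζ (Ioo_subset_Icc_self hζ)⟩ (xc t, t) ⟨hxt, htI⟩ (by
        rw [Prod.dist_eq, dist_self, Real.dist_eq]
        rw [abs_of_neg (by linarith)] at hd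
        have : |ζ - t| < η := by rw [abs_of_neg (by linarith [hζ.2])]; linarith [hζ.1]
        exact max_lt hη this)
      rw [Real.dist_eq] at h5
      simp only [tD] at h5 hlow
      have h6 := neg_abs_le (deriv (v (xc t)) ζ - deriv (v (xc t)) t)
      have h7 : deriv (v (xc t)) ζ * (t - s) = v (xc t) t - v (xc t) s := by
        rw [hmv, div_mul_cancel₀]; linarith
      have h8 : (-(C1 - K / 2)) * (t - s) ≤ deriv (v (xc t)) ζ * (t - s) := by
        apply mul_le_mul_of_nonneg_right _ (by linarith)
        rw [hC1]; linarith
      have h9 : f t = v (xc t) t + K * ‖xc t - y‖ ^ 2 + K / 2 * (t0 - t) := by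
        simp only [hf, hφ, hgv _ hxt t htI]
      have h10 : φ y (xc t, s) = v (xc t) s + K * ‖xc t - y‖ ^ 2 + K / 2 * (t0 - s) := by
        simp only [hφ, hgv _ hxt s hsI]
      rw [abs_of_nonneg (by linarith), abs_of_neg (by linarith)]
      linarith
    have hlip : ∀ s ∈ Ty, ∀ t ∈ Ty, |s - t| < η → |f s - f t| ≤ C1 * |s - t| := by
      intro s hs t ht hd
      rcases lt_trichotomy s t with h3 | h3 | h3
      · exact hlip1 s hs t ht h3 hd
      · subst h3; simp
      · rw [abs_sub_comm s t, abs_sub_comm (f s)]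
        exact hlip1 t ht s hs h3 (by rw [abs_sub_comm]; exact hd)
    have himg := ks_image_measure f ⟨C1, hC1p.le⟩ hη hTym hlip
    have h3 : ENNReal.ofReal (l / 4) ≤ ENNReal.ofReal C1 * volume Ty := by
      calc ENNReal.ofReal (l / 4) = volume (Icc h1 h2) := by
            rw [Real.volume_Icc, hh1, hh2]; congr 1; ring
        _ ≤ volume (f '' Ty) := measure_mono hsurj
        _ ≤ _ := by
          refine himg.trans (le_of_eq ?_)
          congr 1
          rw [ENNReal.ofReal, Real.toNNReal_of_nonneg hC1p.le]
          rfl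
    have h4 : ENNReal.ofReal (r ^ 2 / (4 * (4 * (n * θ⁻¹ + 2 * Lam) + 2))) =
        ENNReal.ofReal (l / 4) / ENNReal.ofReal C1 := by
      rw [← ENNReal.ofReal_div_of_pos hC1p]
      congr 1
      rw [hC1, hK]
      field_simp
      ring
    rw [h4]
    refine ENNReal.div_le_of_le_mul ?_
    rw [mul_comm]; exact h3
  -- upper bound on sections in space
  set Bad : Set (Eu n × ℝ) := {p | p ∈ Cy ∧ v p.1 p.2 < l} with hBad
  have hBadm : MeasurableSet Bad := by
    have : Bad = Cy ∩ {p | g p < l} := by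
      ext ⟨x, t⟩
      constructor
      · rintro ⟨h3, h4⟩
        refine ⟨h3, ?_⟩
        simp only [mem_ofPred_eq, hgv x h3.1 t h3.2]; exact h4
      · rintro ⟨h3, h4⟩
        refine ⟨h3, ?_⟩
        simpa only [mem_ofPred_eq, hgv x h3.1 t h3.2] using h4
    rw [this]
    exact hCyc.measurableSet.inter (isOpen_lt g.continuous continuous_const).measurableSet
  set C2 : ℝ := (θ⁻¹ * (n * θ⁻¹ + 1 / 4 + 2 * Lam)) ^ n with hC2
  have hspace : ∀ t, volume ((fun y => (y, t)) ⁻¹' T) ≤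
      ENNReal.ofReal C2 * volume ((fun x => (x, t)) ⁻¹' Bad) := by
    intro t
    by_cases htI : t ∈ Icc a t0
    swap
    · have : (fun y => (y, t)) ⁻¹' T = ∅ := by
        rw [eq_empty_iff_forall_notMem]
        rintro y ⟨⟨x, y', t'⟩, hq, hq'⟩
        simp only [Prod.mk.injEq] at hq'
        rw [hq'.1, hq'.2] at hq
        exact htI ((hZmem _ _ _).1 hq).2.2.1
      rw [this, measure_empty]; exact zero_le
    set G : Eu n → Eu n := fun z => z + (2 * K)⁻¹ • gradient (fun y => v y t) z with hG
    set S : Set (Eu n) := (ball x0 r ∩ {x | g (x, t) < l}) ∩ {x | |(fderiv ℝ G x).det| ≤ C2} with hS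
    have hSm : MeasurableSet S := by
      refine (measurableSet_ball.inter ?_).inter ?_
      · exact (isOpen_lt (g.continuous.comp (by fun_prop : Continuous fun x : Eu n => (x, t)))
          continuous_const).measurableSet
      · have : Measurable fun x => |(fderiv ℝ G x).det| :=
          (ContinuousLinearMap.continuous_det.measurable.comp (measurable_fderiv ℝ G)).abs
        exact measurableSet_le this measurable_const
    have hcdx : ∀ x ∈ S, ContDiffAt ℝ 2 (fun y => v y t) x := fun x hx =>
      hv.cd x t (hsub ⟨ball_subset_closedBall hx.1.1, htI⟩)
    have hsubS : (fun y => (y, t)) ⁻¹' T ⊆ G '' S := by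
      rintro y ⟨⟨x, y', t'⟩, hq, hq'⟩
      simp only [Prod.mk.injEq] at hq'
      rw [hq'.1, hq'.2] at hq
      obtain ⟨f1, f2, f3, f4, f5, f6⟩ := hfacts _ _ _ hq
      refine ⟨x, ⟨⟨f1, ?_⟩, ?_⟩, f4.symm⟩
      · simp only [mem_ofPred_eq, hgv x (ball_subset_closedBall f1) t htI]; exact f3
      · have := (ks_contact_map (hv.cd x t (hsub ⟨ball_subset_closedBall f1, htI⟩)) (2 * K)⁻¹).2
        simp only [mem_ofPred_eq, hG]
        rw [this]
        exact f6
    have hsubB : S ⊆ (fun x => (x, t)) ⁻¹' Bad := by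
      intro x hx
      have hxB := ball_subset_closedBall hx.1.1
      refine ⟨⟨hxB, htI⟩, ?_⟩
      simp only
      rw [← hgv x hxB t htI]; exact hx.1.2
    calc volume ((fun y => (y, t)) ⁻¹' T) ≤ volume (G '' S) := measure_mono hsubS
      _ ≤ ∫⁻ x in S, ENNReal.ofReal |(fderiv ℝ G x).det| :=
        addHaar_image_le_lintegral_abs_det_fderiv volume hSm fun x hx =>
          (ks_contact_map (hcdx x hx) (2 * K)⁻¹).1.hasFDerivAt.hasFDerivWithinAt
      _ ≤ ∫⁻ _ in S, ENNReal.ofReal C2 :=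
        setLIntegral_mono' hSm fun x hx => ENNReal.ofReal_le_ofReal hx.2
      _ = ENNReal.ofReal C2 * volume S := by rw [setLIntegral_const]
      _ ≤ _ := by gcongr
  calc volume Y * ENNReal.ofReal (r ^ 2 / (4 * (4 * (n * θ⁻¹ + 2 * Lam) + 2)))
      = ∫⁻ _ in Y, ENNReal.ofReal (r ^ 2 / (4 * (4 * (n * θ⁻¹ + 2 * Lam) + 2))) := by
        rw [setLIntegral_const, mul_comm]
    _ ≤ ∫⁻ y in Y, volume (Prod.mk y ⁻¹' T) :=
        setLIntegral_mono' measurableSet_closedBall hsec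
    _ ≤ ∫⁻ y, volume (Prod.mk y ⁻¹' T) := setLIntegral_le_lintegral _ _
    _ = volume T := by rw [Measure.volume_eq_prod, Measure.prod_apply hTm]
    _ = ∫⁻ t, volume ((fun y => (y, t)) ⁻¹' T) := by
        rw [Measure.volume_eq_prod, Measure.prod_apply_symm hTm]
    _ ≤ ∫⁻ t, ENNReal.ofReal C2 * volume ((fun x => (x, t)) ⁻¹' Bad) := lintegral_mono hspace
    _ = ENNReal.ofReal C2 * volume Bad := by
        rw [lintegral_const_mul _ (measurable_measure_prodMk_right hBadm), Measure.volume_eq_prod,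
          Measure.prod_apply_symm hBadm]

open MeasureTheory in
/-- Measure to point estimate. -/
lemma ks_measure_point (θ Lam : ℝ) (hθ : 0 < θ) (hLam : 0 ≤ Lam) : ∃ δ : ℝ, 0 < δ ∧
    ∀ (v : Eu n → ℝ → ℝ) (U : Set (Eu n × ℝ)), KSol θ Lam v U →
    ∀ (x0 : Eu n) (t0 r l : ℝ), 0 < r → r ≤ 1 → 0 < l →
    closedBall x0 r ×ˢ Icc (t0 - r ^ 2) t0 ⊆ U →
    (∀ x ∈ closedBall x0 r, ∀ t ∈ Icc (t0 - r ^ 2) t0, 0 ≤ v x t) →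
    volume {p : Eu n × ℝ | p ∈ closedBall x0 r ×ˢ Icc (t0 - r ^ 2) t0 ∧ v p.1 p.2 < l} ≤
      ENNReal.ofReal (δ * r ^ (n + 2)) → l / 2 ≤ v x0 t0 := by
  set ω : ℝ := (volume (ball (0 : Eu n) 1)).toReal with hω
  have hωp : 0 < ω := ENNReal.toReal_pos (measure_ball_pos _ _ one_pos).ne' measure_ball_lt_top.ne
  set C1 : ℝ := 4 * (4 * (n * θ⁻¹ + 2 * Lam) + 2) with hC1
  have hn0 : 0 ≤ n * θ⁻¹ := by positivity
  have hC1p : 0 < C1 := by positivity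
  set C2 : ℝ := (θ⁻¹ * (n * θ⁻¹ + 1 / 4 + 2 * Lam)) ^ n with hC2
  have hC2p : 0 < C2 := by positivity
  refine ⟨ω / (4 ^ n * C1 * C2 * 2), by positivity, ?_⟩
  intro v U hv x0 t0 r l hr hr1 hl hsub hpos hmeas
  by_contra hcon
  push Not at hcon
  have h := (ks_ABP hθ hLam hv hr hr1 hl hsub hpos hcon).trans (mul_le_mul_right hmeas _)
  rw [← hC1, ← hC2, Measure.addHaar_closedBall _ _ (by positivity), finrank_euclideanSpace_fin,
    ← ENNReal.ofReal_toReal (measure_ball_lt_top (μ := volume) (x := (0 : Eu n)) (r := 1)).ne, ← hω,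
    ← ENNReal.ofReal_mul (by positivity), ← ENNReal.ofReal_mul (by positivity),
    ← ENNReal.ofReal_mul (by positivity), ENNReal.ofReal_le_ofReal_iff (by positivity)] at h
  have e1 : (r / 4) ^ n * ω * (r ^ 2 / C1) = 2 * (C2 * (ω / (4 ^ n * C1 * C2 * 2) * r ^ (n + 2))) := by
    rw [div_pow, pow_add]; field_simp
  have e2 : 0 < C2 * (ω / (4 ^ n * C1 * C2 * 2) * r ^ (n + 2)) := by positivity
  linarith

/-- Later cylinder attached to `z`. -/
def ksQ (z : Eu n × ℝ) (r : ℝ) : Set (Eu n × ℝ) :=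
  ball z.1 r ×ˢ Ioo (z.2 + r ^ 2) (z.2 + 2 * r ^ 2)

open MeasureTheory in
/-- Volume of the unit ball. -/
def ksω (n : ℕ) : ℝ := (volume (ball (0 : Eu n) 1)).toReal

open MeasureTheory in
lemma ksω_pos : 0 < ksω n :=
  ENNReal.toReal_pos (measure_ball_pos _ _ one_pos).ne' measure_ball_lt_top.ne

open MeasureTheory in
lemma ks_vol_ball (x : Eu n) {R : ℝ} (hR : 0 < R) :
    volume (ball x R) = ENNReal.ofReal (ksω n * R ^ n) := by
  rw [Measure.addHaar_ball_of_pos _ _ hR, finrank_euclideanSpace_fin,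
    ← ENNReal.ofReal_toReal (measure_ball_lt_top (μ := volume) (x := (0 : Eu n)) (r := 1)).ne,
    ← ENNReal.ofReal_mul (by positivity), mul_comm]
  rfl

open MeasureTheory in
lemma ks_vol_box (x : Eu n) {R a b : ℝ} (hR : 0 < R) :
    volume (ball x R ×ˢ Ioo a b) = ENNReal.ofReal (ksω n * R ^ n * (b - a)) := by
  have := ksω_pos (n := n)
  rw [Measure.volume_eq_prod, Measure.prod_prod, ks_vol_ball x hR, Real.volume_Ioo,
    ← ENNReal.ofReal_mul (by positivity)]

open MeasureTheory in
lemma ks_vol_Q (z : Eu n × ℝ) {r : ℝ} (hr : 0 < r) :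
    volume (ksQ z r) = ENNReal.ofReal (ksω n * r ^ (n + 2)) := by
  rw [ksQ, ks_vol_box _ hr]
  congr 1
  ring

open MeasureTheory in
/-- The set `E` fills most of the later cylinder. -/
def ksGood (δ : ℝ) (E : Set (Eu n × ℝ)) (z : Eu n × ℝ) (r : ℝ) : Prop :=
  volume (ksQ z r \ E) ≤ ENNReal.ofReal δ * volume (ksQ z r)

lemma ks_good_small {δ : ℝ} {E : Set (Eu n × ℝ)} (hE : IsOpen E) {z : Eu n × ℝ} (hz : z ∈ E)
    {ρ : ℝ} (hρ : 0 < ρ) : ∃ r, 0 < r ∧ r < ρ ∧ ksGood δ E z r := by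
  obtain ⟨ε, hε, hball⟩ := Metric.isOpen_iff.1 hE z hz
  set r := min (min (ρ / 2) (ε / 2)) (1 / 2) with hr
  have hrp : 0 < r := by simp only [hr, lt_min_iff]; exact ⟨⟨by linarith, by linarith⟩, by norm_num⟩
  have h1 : r ≤ ρ / 2 := (min_le_left _ _).trans (min_le_left _ _)
  have h2 : r ≤ ε / 2 := (min_le_left _ _).trans (min_le_right _ _)
  have h3 : r ≤ 1 / 2 := min_le_right _ _
  refine ⟨r, hrp, by linarith, ?_⟩
  have : ksQ z r \ E = ∅ := by
    rw [sdiff_eq_empty]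
    refine Subset.trans ?_ hball
    rintro ⟨x, t⟩ ⟨hx, ht⟩
    simp only [mem_ball, mem_Ioo] at hx ht
    rw [mem_ball, Prod.dist_eq, max_lt_iff, Real.dist_eq]
    refine ⟨by simp only; linarith, ?_⟩
    simp only
    rw [abs_lt]
    constructor <;> nlinarith [sq_nonneg r]
  rw [ksGood, this, MeasureTheory.measure_empty]
  exact zero_le

lemma ks_good_stop {δ : ℝ} {E : Set (Eu n × ℝ)} (hE : IsOpen E) {z : Eu n × ℝ} (hz : z ∈ E)
    {ρ : ℝ} (hρ : 0 < ρ) (hbad : ∀ r, ρ ≤ r → r < 2 * ρ → ¬ ksGood δ E z r) :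
    ∃ r, 0 < r ∧ r < ρ ∧ ksGood δ E z r ∧ ¬ ksGood δ E z (2 * r) := by
  classical
  obtain ⟨r0, hr0, hr0ρ, hg0⟩ := ks_good_small (δ := δ) hE hz hρ
  have hex : ∃ k : ℕ, ρ ≤ 2 ^ k * r0 := by
    obtain ⟨k, hk⟩ := pow_unbounded_of_one_lt (ρ / r0) (one_lt_two (α := ℝ))
    exact ⟨k, by rw [div_lt_iff₀ hr0] at hk; exact hk.le⟩
  have hk1 := Nat.find_spec hex
  have hk0 : Nat.find hex ≠ 0 := by
    intro h
    rw [h] at hk1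
    simp at hk1; linarith
  have hlt : ∀ j < Nat.find hex, 2 ^ j * r0 < ρ := fun j hj => not_le.1 (Nat.find_min hex hj)
  have hbk : ¬ ksGood δ E z (2 ^ (Nat.find hex) * r0) := by
    refine hbad _ hk1 ?_
    obtain ⟨j, hj⟩ := Nat.exists_eq_succ_of_ne_zero hk0
    rw [hj, Nat.succ_eq_add_one, pow_succ]
    have := hlt j (by omega)
    linarith
  have hex2 : ∃ j : ℕ, ¬ ksGood δ E z (2 ^ j * r0) := ⟨_, hbk⟩
  have hj1 := Nat.find_spec hex2
  have hj0 : Nat.find hex2 ≠ 0 := by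
    intro h
    rw [h] at hj1
    simp at hj1; exact hj1 hg0
  obtain ⟨j, hj⟩ := Nat.exists_eq_succ_of_ne_zero hj0
  have hle : Nat.find hex2 ≤ Nat.find hex := Nat.find_min' hex2 hbk
  refine ⟨2 ^ j * r0, by positivity, hlt j (by omega), ?_, ?_⟩
  · have := Nat.find_min hex2 (m := j) (by omega)
    push Not at this
    exact this
  · rw [hj, Nat.succ_eq_add_one, pow_succ] at hj1
    rw [show 2 * (2 ^ j * r0) = 2 ^ j * 2 * r0 by ring]
    exact hj1

open MeasureTheory in
/-- Growing ink spots. -/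
lemma ks_ink {δ : ℝ} (hδ : 0 < δ) {E F : Set (Eu n × ℝ)} (hE : IsOpen E) (hF : MeasurableSet F)
    (hEF : E ⊆ F) (hFfin : volume F ≠ ∞) {ρ : ℝ} (hρ : 0 < ρ)
    (hbad : ∀ z ∈ E, ∀ r, ρ ≤ r → r < 2 * ρ → ¬ ksGood δ E z r)
    (hgood : ∀ z ∈ E, ∀ r, 0 < r → r < ρ → ksGood δ E z r → ksQ z (2 * r) ⊆ F) :
    (1 + δ / (12 * 3 ^ n)) * (volume E).toReal ≤ (volume F).toReal := by
  have hω := ksω_pos (n := n)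
  have hst : ∀ z : Eu n × ℝ, ∃ r, z ∈ E → 0 < r ∧ r < ρ ∧ ksGood δ E z r ∧ ¬ ksGood δ E z (2 * r) := by
    intro z
    by_cases hz : z ∈ E
    · obtain ⟨r, hr⟩ := ks_good_stop (δ := δ) hE hz hρ (hbad z hz)
      exact ⟨r, fun _ => hr⟩
    · exact ⟨0, fun h => absurd h hz⟩
  choose R hR using hst
  set Bx : Eu n × ℝ → Set (Eu n × ℝ) := fun z =>
    ball z.1 (2 * R z) ×ˢ Ioo (z.2 - R z ^ 2) (z.2 + 8 * R z ^ 2) with hBx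
  have hzB : ∀ z ∈ E, z ∈ Bx z := by
    intro z hz
    have := (hR z hz).1
    refine ⟨mem_ball_self (by linarith), ?_, ?_⟩ <;> nlinarith [sq_pos_of_pos this]
  obtain ⟨u, huE, hdis, hcov⟩ := Vitali.exists_disjoint_subfamily_covering_enlargement Bx E R 2
    one_lt_two (fun z hz => (hR z hz).1.le) ρ (fun z hz => (hR z hz).2.1.le)
    (fun z hz => ⟨z, hzB z hz⟩)
  have hucount : u.Countable := by
    refine hdis.countable_of_isOpen (fun z hz => isOpen_ball.prod isOpen_Ioo) ?_
    exact fun z hz => ⟨z, hzB z (huE hz)⟩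
  set En : Eu n × ℝ → Set (Eu n × ℝ) := fun z =>
    ball z.1 (6 * R z) ×ˢ Ioo (z.2 - 33 * R z ^ 2) (z.2 + 12 * R z ^ 2) with hEn
  have hEcov : E ⊆ ⋃ z ∈ u, En z := by
    intro a ha
    obtain ⟨b, hb, ⟨q, hqa, hqb⟩, hab⟩ := hcov a ha
    refine mem_biUnion hb ?_
    have ha0 := (hR a ha).1
    have hsq : R a ^ 2 ≤ 4 * R b ^ 2 := by nlinarith
    obtain ⟨⟨h1, h2, h3⟩, ⟨h4, h5, h6⟩⟩ := And.intro hqa hqb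
    rw [mem_ball] at h1 h4
    refine ⟨?_, ?_, ?_⟩
    · rw [mem_ball]
      have := dist_triangle_left a.1 b.1 q.1
      linarith
    · linarith
    · linarith
  have hvolEn : ∀ z ∈ u, ENNReal.ofReal δ * volume (En z) ≤
      ENNReal.ofReal (12 * 3 ^ n) * volume (ksQ z (2 * R z) \ E) := by
    intro z hz
    have hr := (hR z (huE hz)).1
    have hng := (hR z (huE hz)).2.2.2
    simp only [ksGood, not_le] at hng
    calc ENNReal.ofReal δ * volume (En z)
        ≤ ENNReal.ofReal δ * (ENNReal.ofReal (12 * 3 ^ n) * volume (ksQ z (2 * R z))) := by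
          gcongr
          rw [ks_vol_Q z (by linarith), hEn, ks_vol_box _ (by linarith),
            ← ENNReal.ofReal_mul (by positivity)]
          apply ENNReal.ofReal_le_ofReal
          have e1 : ksω n * (6 * R z) ^ n * (z.2 + 12 * R z ^ 2 - (z.2 - 33 * R z ^ 2)) =
            (3 ^ n * ksω n * (2 * R z) ^ n * R z ^ 2) * 45 := by
            rw [show (6 * R z) = 3 * (2 * R z) by ring, mul_pow 3]; ring
          have e2 : 12 * 3 ^ n * (ksω n * (2 * R z) ^ (n + 2)) =
            (3 ^ n * ksω n * (2 * R z) ^ n * R z ^ 2) * 48 := by ring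
          rw [e1, e2]
          gcongr
          norm_num
      _ = ENNReal.ofReal (12 * 3 ^ n) * (ENNReal.ofReal δ * volume (ksQ z (2 * R z))) := by ring
      _ ≤ _ := by gcongr
  have hmain : ENNReal.ofReal δ * volume E ≤ ENNReal.ofReal (12 * 3 ^ n) * volume (F \ E) := by
    have hQB : ∀ z ∈ u, ksQ z (2 * R z) ⊆ Bx z := by
      rintro z hz ⟨x, t⟩ ⟨h1, h2, h3⟩
      have hr := (hR z (huE hz)).1
      refine ⟨h1, ?_, ?_⟩ <;> simp only at h2 h3 ⊢ <;> nlinarith [sq_pos_of_pos hr]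
    have hdis2 : u.PairwiseDisjoint fun z => ksQ z (2 * R z) \ E :=
      hdis.mono_on fun z hz => sdiff_subset.trans (hQB z hz)
    calc ENNReal.ofReal δ * volume E ≤ ENNReal.ofReal δ * volume (⋃ z ∈ u, En z) := by gcongr
      _ ≤ ENNReal.ofReal δ * ∑' z : u, volume (En z) := by
        gcongr; exact measure_biUnion_le _ hucount _
      _ = ∑' z : u, ENNReal.ofReal δ * volume (En z) := ENNReal.tsum_mul_left.symm
      _ ≤ ∑' z : u, ENNReal.ofReal (12 * 3 ^ n) * volume (ksQ z.1 (2 * R z) \ E) :=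
        ENNReal.tsum_le_tsum fun z => hvolEn z z.2
      _ = ENNReal.ofReal (12 * 3 ^ n) * ∑' z : u, volume (ksQ z.1 (2 * R z) \ E) :=
        ENNReal.tsum_mul_left
      _ = ENNReal.ofReal (12 * 3 ^ n) * volume (⋃ z ∈ u, ksQ z (2 * R z) \ E) := by
        rw [measure_biUnion hucount hdis2 fun z hz =>
          ((isOpen_ball.prod isOpen_Ioo).measurableSet.diff hE.measurableSet)]
      _ ≤ _ := by
        gcongr
        refine iUnion₂_subset fun z hz => sdiff_subset_sdiff_left ?_
        have hr := hR z (huE hz)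
        exact hgood z (huE hz) _ hr.1 hr.2.1 hr.2.2.1
  have hEfin : volume E ≠ ∞ := measure_ne_top_of_subset hEF hFfin
  have hDfin : volume (F \ E) ≠ ∞ := measure_ne_top_of_subset sdiff_subset hFfin
  have hsum : volume E + volume (F \ E) = volume F := by
    rw [add_comm, ← measure_union disjoint_sdiff_left hE.measurableSet, sdiff_union_of_subset hEF]
  rw [← hsum, ENNReal.toReal_add hEfin hDfin]
  have h1 := ENNReal.toReal_mono (ENNReal.mul_ne_top ENNReal.ofReal_ne_top hDfin) hmain
  rw [ENNReal.toReal_mul, ENNReal.toReal_mul, ENNReal.toReal_ofReal hδ.le,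
    ENNReal.toReal_ofReal (by positivity)] at h1
  have h2 : δ / (12 * 3 ^ n) * (volume E).toReal ≤ (volume (F \ E)).toReal := by
    rw [div_mul_eq_mul_div, div_le_iff₀ (by positivity)]
    linarith
  linarith

/-- Standing assumptions for the Harnack inequality. -/
structure KDom (θ Lam R T : ℝ) (xs : Eu n) (ts : ℝ) (v : Eu n → ℝ → ℝ) : Prop where
  ksol : KSol θ Lam v (ball 0 R ×ˢ Ioo 0 T)
  nonneg : ∀ x ∈ ball (0 : Eu n) R, ∀ t ∈ Ioo 0 T, 0 ≤ v x t
  hR : 3 ≤ R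
  hxs : ‖xs‖ ≤ R - 2
  hts : 8 ≤ ts
  htT : ts < T

lemma ks_seg {x0 x1 y : Eu n} {t0 t1 τ ρ M : ℝ} (ht : t0 < t1) (hτ : τ ∈ Icc t0 t1)
    (h0 : ‖x0‖ ≤ M) (h1 : ‖x1‖ ≤ M)
    (hy : ‖y - (x0 + (τ - t0) • ((t1 - t0)⁻¹ • (x1 - x0)))‖ ≤ ρ) : ‖y‖ ≤ M + ρ := by
  set s := (τ - t0) * (t1 - t0)⁻¹ with hs
  have hp : 0 < t1 - t0 := by linarith
  have hs0 : 0 ≤ s := mul_nonneg (by linarith [hτ.1]) (by positivity)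
  have hs1 : s ≤ 1 := by
    rw [hs, ← div_eq_mul_inv, div_le_one hp]; linarith [hτ.2]
  have e : x0 + (τ - t0) • ((t1 - t0)⁻¹ • (x1 - x0)) = (1 - s) • x0 + s • x1 := by
    rw [smul_smul, ← hs, smul_sub, sub_smul, one_smul]; abel
  rw [e] at hy
  have h2 : ‖(1 - s) • x0 + s • x1‖ ≤ M := by
    refine (norm_add_le _ _).trans ?_
    rw [norm_smul, norm_smul, Real.norm_of_nonneg hs0, Real.norm_of_nonneg (by linarith)]
    have := mul_le_mul_of_nonneg_left h0 (by linarith : 0 ≤ 1 - s)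
    have := mul_le_mul_of_nonneg_left h1 hs0
    linarith
  have := norm_sub_norm_le y ((1 - s) • x0 + s • x1)
  linarith

open MeasureTheory in
lemma ks_local (θ Lam R : ℝ) (hθ : 0 < θ) (hLam : 0 ≤ Lam) (hR : 3 ≤ R) :
    ∃ δ : ℝ, 0 < δ ∧ ∃ γ1 γ2 : ℕ, ∀ (T : ℝ) (xs : Eu n) (ts : ℝ) (v : Eu n → ℝ → ℝ),
    KDom θ Lam R T xs ts v → ∀ (x : Eu n) (t r l : ℝ), ‖x‖ ≤ 1 → ts - 6 ≤ t → t ≤ ts - 3 →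
    0 < r → r ≤ 1 / 4 → 0 < l → ksGood δ {p | l < v p.1 p.2} (x, t) r →
    (∀ p ∈ ksQ (x, t) (2 * r), (1 / 2) ^ (γ1 + 2) * l < v p.1 p.2) ∧ l / 2 * r ^ γ2 ≤ v xs ts := by
  have hω := ksω_pos (n := n)
  obtain ⟨δA, hδA, HA⟩ := ks_measure_point (n := n) θ Lam hθ hLam
  obtain ⟨γ1, HB1⟩ := ks_barrier (n := n) θ Lam 2 7 2 hθ hLam (by norm_num) (by norm_num) (by norm_num)
  obtain ⟨γ2, HB2⟩ := ks_barrier (n := n) θ Lam 4 28 (2 * (R - 1)) hθ hLam (by norm_num) (by norm_num)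
    (by linarith)
  refine ⟨δA / (ksω n * 4 ^ (n + 2)), by positivity, γ1, γ2, ?_⟩
  intro T xs ts v hv x t r l hx ht1 ht2 hr hr4 hl hgood
  have hts := hv.hts
  have htT := hv.htT
  have hr2 : r ^ 2 ≤ 1 / 16 := by nlinarith
  have hr2p : 0 < r ^ 2 := by positivity
  set s0 := t + 7 / 4 * r ^ 2 with hs0
  have hbase : ∀ y, ‖y - x‖ ≤ r / 2 → l / 2 ≤ v y s0 := by
    intro y hy
    have hcyl : closedBall y (r / 4) ×ˢ Icc (s0 - (r / 4) ^ 2) s0 ⊆ ksQ (x, t) r := by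
      rintro ⟨x', t'⟩ ⟨h1, h2, h3⟩
      simp only [mem_closedBall, dist_eq_norm] at h1 h2 h3
      refine ⟨?_, ?_, ?_⟩
      · rw [mem_ball, dist_eq_norm]
        have := norm_sub_le_norm_sub_add_norm_sub x' y x
        simp only
        linarith
      · simp only; nlinarith
      · simp only; nlinarith
    have hin : ksQ (x, t) r ⊆ ball 0 R ×ˢ Ioo 0 T := by
      rintro ⟨x', t'⟩ ⟨h1, h2, h3⟩
      simp only [mem_ball, dist_eq_norm] at h1 h2 h3
      refine ⟨?_, ?_, ?_⟩
      · rw [mem_ball_zero_iff]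
        have := norm_sub_norm_le x' x
        simp only
        linarith
      · simp only; linarith
      · simp only; linarith
    refine HA v _ hv.ksol y s0 (r / 4) l (by linarith) (by linarith) hl (hcyl.trans hin) ?_ ?_
    · intro x' hx' t' ht'
      have := hin (hcyl ⟨hx', ht'⟩ : (x', t') ∈ _)
      exact hv.nonneg x' this.1 t' this.2
    · refine (measure_mono ?_).trans (hgood.trans (le_of_eq ?_))
      · rintro p ⟨hp1, hp2⟩
        refine ⟨hcyl hp1, ?_⟩
        simp only [mem_ofPred_eq, not_lt]; exact hp2.le
      · rw [ks_vol_Q _ hr, ← ENNReal.ofReal_mul (by positivity)]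
        congr 1
        rw [div_pow]; field_simp
  constructor
  · rintro ⟨x1, t1⟩ ⟨h1, h2, h3⟩
    simp only [mem_ball, dist_eq_norm] at h1 h2 h3
    have hx1 : ‖x1‖ ≤ 3 / 2 := by
      have := norm_sub_norm_le x1 x
      linarith
    have hlt : s0 < t1 := by rw [hs0]; nlinarith
    have := HB1 v _ hv.ksol x x1 s0 t1 r (1 / 2) (l / 2) hr (by linarith) (by norm_num) le_rfl
      (by linarith) (by rw [hs0]; nlinarith) (by rw [hs0]; nlinarith) h1.le (by
        intro τ hτ y hy
        have hyn := ks_seg (M := 3 / 2) hlt hτ (by linarith) hx1 hy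
        have hyb : y ∈ ball (0 : Eu n) R := by rw [mem_ball_zero_iff]; linarith
        have hτT : τ ∈ Ioo 0 T := ⟨by linarith [hτ.1], by linarith [hτ.2]⟩
        exact ⟨⟨hyb, hτT⟩, hv.nonneg y hyb τ hτT⟩) (by
        intro y hy
        exact hbase y (by linarith))
    refine lt_of_lt_of_le ?_ this
    have hp : (0:ℝ) < (1 / 2) ^ γ1 := by positivity
    rw [pow_add]
    nlinarith [mul_pos hp hl]
  · have hlt : s0 < ts := by rw [hs0]; linarith
    have hxs := hv.hxs
    refine HB2 v _ hv.ksol x xs s0 ts (1 / 2) r (l / 2) (by norm_num) (by norm_num) hr (by linarith)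
      (by linarith) (by rw [hs0]; linarith) (by rw [hs0]; linarith) ?_ ?_ ?_
    · have := norm_sub_le xs x
      linarith
    · intro τ hτ y hy
      have hyn := ks_seg (M := R - 2) hlt hτ (by linarith) hxs hy
      have hyb : y ∈ ball (0 : Eu n) R := by rw [mem_ball_zero_iff]; linarith
      have hτT : τ ∈ Ioo 0 T := ⟨by linarith [hτ.1], by linarith [hτ.2]⟩
      exact ⟨⟨hyb, hτT⟩, hv.nonneg y hyb τ hτT⟩
    · intro y hy
      exact hbase y (by linarith)

open MeasureTheory in
set_option maxHeartbeats 1600000 in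
/-- Small measure of superlevel sets when the value at the reference point is small. -/
lemma ks_weak (θ Lam R : ℝ) (hθ : 0 < θ) (hLam : 0 ≤ Lam) (hR : 3 ≤ R) (δ : ℝ) (hδ : 0 < δ) :
    ∃ K : ℝ, 0 < K ∧ ∃ γ : ℕ, ∀ (T : ℝ) (xs : Eu n) (ts : ℝ) (v : Eu n → ℝ → ℝ),
    KDom θ Lam R T xs ts v → ∀ (x : Eu n) (t r l : ℝ), ‖x‖ ≤ 1 / 2 → ts - 5 ≤ t → t ≤ ts - 4 →
    0 < r → r ≤ 1 / 8 → 0 < l → v xs ts < K * l * r ^ γ →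
    volume {p : Eu n × ℝ | p ∈ closedBall x r ×ˢ Icc (t - r ^ 2) t ∧ l < v p.1 p.2} ≤
      ENNReal.ofReal (δ * r ^ (n + 2)) := by
  have hω := ksω_pos (n := n)
  obtain ⟨δ', hδ', γ1, γ2, H⟩ := ks_local (n := n) θ Lam R hθ hLam hR
  set η : ℝ := δ' / (12 * 3 ^ n) with hη
  have hηp : 0 < η := by positivity
  obtain ⟨N0, hN0⟩ := pow_unbounded_of_one_lt (ksω n * 3 ^ n * 4 / δ) (by linarith : 1 < 1 + η)
  set N := N0 + 1 with hN
  have hNN : ksω n * 3 ^ n * 4 / δ ≤ (1 + η) ^ N :=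
    hN0.le.trans (pow_le_pow_right₀ (by linarith) (by omega))
  have hN1 : (1:ℝ) ≤ N := by rw [hN]; push_cast; linarith [(Nat.cast_nonneg N0 : (0:ℝ) ≤ N0)]
  set c1 : ℝ := (1 / 2) ^ (γ1 + 2) with hc1
  have hc1p : 0 < c1 := by positivity
  have hc1l : c1 ≤ 1 := pow_le_one₀ (by norm_num) (by norm_num)
  refine ⟨c1 ^ N / 2 * (1 / (4 * N)) ^ γ2, by positivity, γ2, ?_⟩
  intro T xs ts v hv x t r l hx ht1 ht2 hr hr8 hl hsmall
  have hts := hv.hts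
  have htT := hv.htT
  have hr2 : r ^ 2 ≤ 1 / 64 := by nlinarith
  have hr2p : 0 < r ^ 2 := by positivity
  set ρ : ℝ := r / (4 * N) with hρ
  have hρp : 0 < ρ := by positivity
  have hρN : N * ρ = r / 4 := by rw [hρ]; field_simp
  have hρr : ρ ≤ r / 4 := by nlinarith
  set G : ℕ → Set (Eu n × ℝ) := fun k => ball x (2 * r + 2 * k * ρ) ×ˢ
    Ioo (t - 2 * r ^ 2) (t + r ^ 2 + 8 * k * ρ ^ 2) with hG
  set E : ℕ → Set (Eu n × ℝ) := fun k => G k ∩ {p | c1 ^ k * l < v p.1 p.2} with hE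
  have hkb : ∀ k ≤ N, k * ρ ≤ r / 4 ∧ k * ρ ^ 2 ≤ r ^ 2 / 16 := by
    intro k hk
    have h1 : (k : ℝ) ≤ N := by exact_mod_cast hk
    have h2 : k * ρ ≤ r / 4 := by rw [← hρN]; gcongr
    refine ⟨h2, ?_⟩
    calc k * ρ ^ 2 = (k * ρ) * ρ := by ring
      _ ≤ (r / 4) * (r / 4) := by gcongr
      _ = _ := by ring
  have hGmem : ∀ k ≤ N, ∀ p ∈ G k, ‖p.1‖ ≤ 1 ∧ ts - 6 ≤ p.2 ∧ p.2 ≤ ts - 3 := by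
    rintro k hk ⟨x', t'⟩ ⟨h1, h2, h3⟩
    obtain ⟨h4, h5⟩ := hkb k hk
    simp only [mem_ball, dist_eq_norm] at h1 h2 h3 ⊢
    have := norm_sub_norm_le x' x
    refine ⟨by linarith, by linarith, by linarith⟩
  have hGU : ∀ k ≤ N, G k ⊆ ball 0 R ×ˢ Ioo 0 T := by
    intro k hk p hp
    obtain ⟨h1, h2, h3⟩ := hGmem k hk p hp
    refine ⟨?_, ?_, ?_⟩
    · rw [mem_ball_zero_iff]; linarith
    · linarith
    · linarith
  have hGo : ∀ k, IsOpen (G k) := fun k => isOpen_ball.prod isOpen_Ioo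
  have hEo : ∀ k ≤ N, IsOpen (E k) := by
    intro k hk
    have := (hv.ksol.cont.mono (hGU k hk)).isOpen_inter_preimage (hGo k) (isOpen_Ioi (a := c1 ^ k * l))
    exact this
  have hGvol : ∀ k ≤ N, volume (G k) ≤ ENNReal.ofReal (ksω n * 3 ^ n * 4 * r ^ (n + 2)) := by
    intro k hk
    obtain ⟨h4, h5⟩ := hkb k hk
    have h6 : 0 ≤ k * ρ := by positivity
    simp only [hG]
    rw [ks_vol_box _ (by linarith)]
    apply ENNReal.ofReal_le_ofReal
    calc ksω n * (2 * r + 2 * k * ρ) ^ n * (t + r ^ 2 + 8 * k * ρ ^ 2 - (t - 2 * r ^ 2))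
        ≤ ksω n * (3 * r) ^ n * (4 * r ^ 2) := by
          gcongr
          · nlinarith
          · linarith
          · linarith
      _ = _ := by rw [mul_pow]; ring
  have hEfin : ∀ k ≤ N, volume (E k) ≠ ∞ := fun k hk =>
    ((measure_mono inter_subset_left).trans_lt ((hGvol k hk).trans_lt ENNReal.ofReal_lt_top)).ne
  have hGmono : ∀ k, G k ⊆ G (k + 1) := by
    rintro k ⟨x', t'⟩ ⟨h1, h2, h3⟩
    simp only [mem_ball] at h1 h2 h3
    refine ⟨?_, h2, ?_⟩
    · rw [mem_ball]; push_cast; linarith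
    · push_cast; nlinarith [sq_pos_of_pos hρp]
  have hpowl : ∀ k ≤ N, c1 ^ N * l ≤ c1 ^ k * l := fun k hk =>
    mul_le_mul_of_nonneg_right (pow_le_pow_of_le_one hc1p.le hc1l hk) hl.le
  have hstep : ∀ k < N, (1 + η) * (volume (E k)).toReal ≤ (volume (E (k + 1))).toReal := by
    intro k hk
    have hck : 0 < c1 ^ k * l := by positivity
    have hEsub : ∀ z r', ksGood δ' (E k) z r' → ksGood δ' {p : Eu n × ℝ | c1 ^ k * l < v p.1 p.2} z r' := by
      intro z r' hg
      refine le_trans (measure_mono ?_) hg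
      exact sdiff_subset_sdiff_right inter_subset_right
    refine ks_ink hδ' (hEo k hk.le) (hEo (k + 1) hk).measurableSet ?_ (hEfin _ hk) hρp ?_ ?_
    · rintro p ⟨h1, h2⟩
      refine ⟨hGmono k h1, ?_⟩
      simp only [mem_ofPred_eq] at h2 ⊢
      rw [pow_succ]
      nlinarith
    · rintro z hz r' hr'1 hr'2 hg
      obtain ⟨h1, h2, h3⟩ := hGmem k hk.le z hz.1
      have h4 := (H T xs ts v hv z.1 z.2 r' (c1 ^ k * l) h1 h2 h3 (by linarith) (by linarith) hck
        (hEsub z r' hg)).2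
      have h5 : c1 ^ N / 2 * (1 / (4 * N)) ^ γ2 * l * r ^ γ2 ≤ c1 ^ k * l / 2 * r' ^ γ2 := by
        calc c1 ^ N / 2 * (1 / (4 * N)) ^ γ2 * l * r ^ γ2 = c1 ^ N * l / 2 * ρ ^ γ2 := by
              rw [hρ, div_eq_mul_one_div r, mul_pow]; ring
          _ ≤ _ := by
              have := hpowl k hk.le
              gcongr
      linarith
    · rintro z hz r' hr'1 hr'2 hg p hp
      obtain ⟨h1, h2, h3⟩ := hGmem k hk.le z hz.1
      have h4 := (H T xs ts v hv z.1 z.2 r' (c1 ^ k * l) h1 h2 h3 (by linarith) (by linarith) hck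
        (hEsub z r' hg)).1 p hp
      refine ⟨?_, ?_⟩
      · obtain ⟨h5, h6, h7⟩ := hp
        obtain ⟨⟨h8, h9, h10⟩, -⟩ := hz
        rw [mem_ball] at h5 h8
        have hsq : r' ^ 2 ≤ ρ ^ 2 := by gcongr
        have hsq0 : 0 ≤ r' ^ 2 := sq_nonneg _
        refine ⟨?_, ?_, ?_⟩
        · rw [mem_ball]
          have := dist_triangle p.1 z.1 x
          push_cast
          linarith
        · linarith
        · push_cast; linarith
      · simp only [mem_ofPred_eq]
        rw [pow_succ]
        calc c1 ^ k * c1 * l = c1 * (c1 ^ k * l) := by ring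
          _ < _ := h4
  have hiter : ∀ k ≤ N, (1 + η) ^ k * (volume (E 0)).toReal ≤ (volume (E k)).toReal := by
    intro k
    induction k with
    | zero => intro _; simp
    | succ k ih =>
      intro hk
      have h1 := ih (by omega)
      have h2 := hstep k (by omega)
      calc (1 + η) ^ (k + 1) * (volume (E 0)).toReal
          = (1 + η) * ((1 + η) ^ k * (volume (E 0)).toReal) := by ring
        _ ≤ (1 + η) * (volume (E k)).toReal := by gcongr
        _ ≤ _ := h2
  have hfin := hiter N le_rfl
  have hup : (volume (E N)).toReal ≤ ksω n * 3 ^ n * 4 * r ^ (n + 2) :=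
    ENNReal.toReal_le_of_le_ofReal (by positivity)
      ((measure_mono inter_subset_left).trans (hGvol N le_rfl))
  have hE0 : (volume (E 0)).toReal ≤ δ * r ^ (n + 2) := by
    have h1 : ksω n * 3 ^ n * 4 / δ * (volume (E 0)).toReal ≤ ksω n * 3 ^ n * 4 * r ^ (n + 2) :=
      (mul_le_mul_of_nonneg_right hNN ENNReal.toReal_nonneg).trans (hfin.trans hup)
    have hc : 0 < ksω n * 3 ^ n * 4 := by positivity
    rw [div_mul_eq_mul_div, div_le_iff₀ hδ] at h1
    have h2 : ksω n * 3 ^ n * 4 * (volume (E 0)).toReal ≤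
      ksω n * 3 ^ n * 4 * (δ * r ^ (n + 2)) := by linarith
    exact le_of_mul_le_mul_left h2 hc
  refine le_trans (measure_mono ?_) ((ENNReal.le_ofReal_iff_toReal_le (hEfin 0 (by omega))
    (by positivity)).2 hE0)
  rintro ⟨x', t'⟩ ⟨⟨h1, h2, h3⟩, h4⟩
  simp only [mem_closedBall] at h1 h2 h3 h4
  refine ⟨⟨?_, ?_, ?_⟩, ?_⟩
  · rw [mem_ball]; simp only [Nat.cast_zero]; linarith
  · simp only; linarith
  · simp only [Nat.cast_zero]; linarith
  · simp only [mem_ofPred_eq, pow_zero, one_mul]; exact h4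

open MeasureTheory in
/-- One blow-up step. -/
lemma ks_blowup (θ Lam R : ℝ) (hθ : 0 < θ) (hLam : 0 ≤ Lam) (hR : 3 ≤ R) :
    ∃ K : ℝ, 0 < K ∧ ∃ γ : ℕ, ∀ (T : ℝ) (xs : Eu n) (ts : ℝ) (v : Eu n → ℝ → ℝ),
    KDom θ Lam R T xs ts v → ∀ (x : Eu n) (t r M : ℝ), ‖x‖ ≤ 1 / 2 → ts - 5 ≤ t → t ≤ ts - 4 →
    0 < r → r ≤ 1 / 8 → 0 < M → M ≤ v x t → v xs ts < K * M * r ^ γ →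
    ∃ x' t', ‖x' - x‖ ≤ r ∧ t - r ^ 2 ≤ t' ∧ t' ≤ t ∧ (5 / 4) * M ≤ v x' t' := by
  obtain ⟨δ, hδ, hmp⟩ := ks_measure_point (n := n) θ Lam hθ hLam
  obtain ⟨K, hK, γ, hw⟩ := ks_weak (n := n) θ Lam R hθ hLam hR δ hδ
  refine ⟨K / 2, by positivity, γ, ?_⟩
  intro T xs ts v hD x t r M hx ht1 ht2 hr hr8 hM hMv hlt
  by_contra hcon
  push Not at hcon
  have hsub : closedBall x r ×ˢ Icc (t - r ^ 2) t ⊆ ball (0 : Eu n) R ×ˢ Ioo 0 T := by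
    rintro ⟨y, s⟩ ⟨hy, hs⟩
    simp only [mem_closedBall, dist_eq_norm] at hy
    have h3 : ‖y‖ ≤ ‖y - x‖ + ‖x‖ := by simpa using norm_add_le (y - x) x
    have h4 : r ^ 2 ≤ 1 := by nlinarith
    have h5 := hD.hts
    have h6 := hD.htT
    refine ⟨?_, ?_, ?_⟩
    · simp only [mem_ball, dist_zero_right]; linarith
    · have := hs.1; simp only at this ⊢; linarith
    · have := hs.2; simp only at this ⊢; linarith
  have hvol := hw T xs ts v hD x t r (M / 2) hx ht1 ht2 hr hr8 (by positivity)
    (by convert hlt using 1; ring)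
  have key := hmp (fun x t => (5 / 4) * M - v x t) _ (hD.ksol.const_sub ((5 / 4) * M)) x t r
    ((3 / 4) * M) hr (by linarith) (by positivity) hsub ?_ ?_
  · linarith
  · intro y hy s hs
    have := hcon y s (by rwa [← dist_eq_norm]) hs.1 hs.2
    linarith
  · refine le_trans (measure_mono ?_) hvol
    rintro p ⟨hp, hq⟩
    refine ⟨hp, ?_⟩
    linarith

/-- Weak form of the Harnack inequality. -/
lemma ks_harnack (θ Lam R : ℝ) (hθ : 0 < θ) (hLam : 0 ≤ Lam) (hR : 3 ≤ R) :
    ∃ c : ℝ, 0 < c ∧ ∀ (T : ℝ) (xs : Eu n) (ts : ℝ) (v : Eu n → ℝ → ℝ),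
    KDom θ Lam R T xs ts v → 1 ≤ v 0 (ts - 4) → c ≤ v xs ts := by
  obtain ⟨K, hK, γ, hb⟩ := ks_blowup (n := n) θ Lam R hθ hLam hR
  set σ : ℝ := 1 - 1 / (5 * (γ + 1)) with hσ
  have hg : (0 : ℝ) ≤ γ := Nat.cast_nonneg γ
  have hq : 0 < 1 / (5 * ((γ : ℝ) + 1)) := by positivity
  have hq1 : 1 / (5 * ((γ : ℝ) + 1)) ≤ 1 / 5 := by
    apply one_div_le_one_div_of_le <;> linarith
  have hσ0 : 0 < σ := by linarith
  have hσ1 : σ < 1 := by linarith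
  have hσγ : 4 / 5 ≤ σ ^ γ := by
    have h1 := one_add_mul_le_pow (a := -(1 / (5 * ((γ : ℝ) + 1)))) (by linarith) γ
    have h2 : (γ : ℝ) * (1 / (5 * ((γ : ℝ) + 1))) ≤ 1 / 5 := by
      rw [mul_one_div, div_le_div_iff₀ (by positivity) (by positivity)]; linarith
    have h3 : σ = 1 + -(1 / (5 * ((γ : ℝ) + 1))) := by rw [hσ]; ring
    rw [h3]; linarith
  set r0 : ℝ := (1 - σ) / 8 with hr0
  have hr0p : 0 < r0 := by rw [hr0]; linarith
  refine ⟨K * r0 ^ γ, by positivity, ?_⟩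
  intro T xs ts v hD h1
  by_contra hcon
  push Not at hcon
  have hind : ∀ k : ℕ, ∃ (x : Eu n) (t : ℝ), ‖x‖ ≤ (1 - σ ^ k) / 8 ∧ ts - 4 - (1 - σ ^ k) / 8 ≤ t ∧
      t ≤ ts - 4 ∧ (5 / 4) ^ k ≤ v x t := by
    intro k
    induction k with
    | zero => exact ⟨0, ts - 4, by simp, by simp, le_rfl, by simpa using h1⟩
    | succ k ih =>
      obtain ⟨x, t, hx, ht1, ht2, hv⟩ := ih
      have hp0 : 0 < σ ^ k := by positivity
      have hp1 : σ ^ k ≤ 1 := pow_le_one₀ hσ0.le hσ1.le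
      have hrp : 0 < r0 * σ ^ k := by positivity
      have hr8 : r0 * σ ^ k ≤ 1 / 8 := by
        have : r0 * σ ^ k ≤ r0 * 1 := by gcongr
        linarith
      have hc : 1 ≤ (5 / 4 : ℝ) ^ k * (σ ^ k) ^ γ := by
        rw [← pow_mul, mul_comm k γ, pow_mul, ← mul_pow]
        exact one_le_pow₀ (by linarith)
      obtain ⟨x', t', hx', ht1', ht2', hv'⟩ := hb T xs ts v hD x t (r0 * σ ^ k) ((5 / 4) ^ k)
        (by linarith) (by linarith) ht2 hrp hr8 (by positivity) hv (by
          refine hcon.trans_le ?_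
          rw [mul_pow]
          have : K * r0 ^ γ * 1 ≤ K * r0 ^ γ * ((5 / 4 : ℝ) ^ k * (σ ^ k) ^ γ) := by gcongr
          linarith)
      have hrr : (r0 * σ ^ k) ^ 2 ≤ r0 * σ ^ k := by nlinarith
      have he : (1 - σ ^ (k + 1)) / 8 = (1 - σ ^ k) / 8 + r0 * σ ^ k := by
        rw [hr0, pow_succ]; ring
      have h3 : ‖x'‖ ≤ ‖x' - x‖ + ‖x‖ := by simpa using norm_add_le (x' - x) x
      refine ⟨x', t', ?_, ?_, ?_, ?_⟩
      · rw [he]; linarith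
      · rw [he]; linarith
      · linarith
      · rw [pow_succ]; linarith
  have hcomp : IsCompact (closedBall (0 : Eu n) (1 / 2) ×ˢ Icc (ts - 5) (ts - 4)) :=
    (isCompact_closedBall _ _).prod isCompact_Icc
  have hsub : closedBall (0 : Eu n) (1 / 2) ×ˢ Icc (ts - 5) (ts - 4) ⊆
      ball (0 : Eu n) R ×ˢ Ioo 0 T := by
    have h5 := hD.hts
    have h6 := hD.htT
    refine prod_mono (closedBall_subset_ball (by linarith)) ?_
    intro s hs
    exact ⟨by linarith [hs.1], by linarith [hs.2]⟩
  obtain ⟨C, hC⟩ := hcomp.bddAbove_image (hD.ksol.cont.mono hsub)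
  obtain ⟨k, hk⟩ := pow_unbounded_of_one_lt C (by norm_num : (1 : ℝ) < 5 / 4)
  obtain ⟨x, t, hx, ht1, ht2, hv⟩ := hind k
  have hp0 : 0 < σ ^ k := by positivity
  have : v x t ≤ C := hC ⟨(x, t), ⟨by
    simp only [mem_closedBall, dist_zero_right]; linarith, by linarith, ht2⟩, rfl⟩
  linarith

lemma ks_sG_scale (u : Eu n → ℝ → ℝ) (s : ℝ) (hs : s ≠ 0) (y : Eu n) (t : ℝ) :
    sG (fun y t => u (s • y) t) y t = s • sG u (s • y) t := by
  simp only [sG, gradient]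
  have := fderiv_comp_smul (𝕜 := ℝ) (f := fun z => u z t) s (x := y)
  rw [this]
  simp

lemma ks_sH_scale (u : Eu n → ℝ → ℝ) (s : ℝ) (hs : s ≠ 0) (y : Eu n) (t : ℝ) :
    sH (fun y t => u (s • y) t) y t = (s ^ 2) • sH u (s • y) t := by
  ext i j
  simp only [sH, Matrix.smul_apply, ks_sG_scale u s hs, PiLp.smul_apply]
  have := fderiv_comp_smul (𝕜 := ℝ) (f := fun z => s • sG u z t i) s (x := y)
  have h2 := congrFun (fderiv_const_smul_field (𝕜 := ℝ) (f := fun z => sG u z t i) s) (s • y)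
  rw [this, show (fun z => s • sG u z t i) = s • (fun z => sG u z t i) from rfl, h2]
  simp [pow_two, mul_assoc]

lemma ks_rescale {θ Lb ε r₀ T R : ℝ} (hLb : 0 ≤ Lb) (hR : 0 < R)
    {Ω : Set (Eu n)} {b : Eu n → Eu n}
    (hb : LipschitzWith (Real.toNNReal Lb) b) (hb0 : b 0 = 0)
    (hΩ : closedBall (0 : Eu n) r₀ ⊆ Ω) (hε : 0 < ε)
    {A : Eu n → ℝ → Matrix (Fin n) (Fin n) ℝ} (hA : MatC θ A Ω ⊤)
    {u : Eu n → ℝ → ℝ} (hu : Classical21 u Ω ⊤) (hL : SolveL ε A b u Ω ⊤)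
    (hr : R * Real.sqrt ε ≤ r₀) :
    KSol θ (Lb * R) (fun y t => u (Real.sqrt ε • y) t) (ball 0 R ×ˢ Ioo 0 T) := by
  set s := Real.sqrt ε with hs
  have hsp : 0 < s := Real.sqrt_pos.mpr hε
  have hs2 : s ^ 2 = ε := Real.sq_sqrt hε.le
  have hin : ∀ y ∈ ball (0 : Eu n) R, s • y ∈ Ω := by
    intro y hy
    apply hΩ
    simp only [mem_ball, mem_closedBall, dist_zero_right] at hy ⊢
    rw [norm_smul, Real.norm_of_nonneg hsp.le]
    nlinarith
  have hmap : Continuous (fun p : Eu n × ℝ => (s • p.1, p.2)) := by fun_prop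
  have hO : MapsTo (fun p : Eu n × ℝ => (s • p.1, p.2)) (ball 0 R ×ˢ Ioo 0 T) (cylO Ω ⊤) := by
    rintro ⟨y, t⟩ ⟨hy, ht⟩
    exact ⟨hin y hy, ht.1, ENNReal.ofReal_lt_top⟩
  have hC : MapsTo (fun p : Eu n × ℝ => (s • p.1, p.2)) (ball 0 R ×ˢ Ioo 0 T) (cylC Ω ⊤) := by
    rintro ⟨y, t⟩ ⟨hy, ht⟩
    exact ⟨subset_closure (hin y hy), ht.1.le, le_top⟩
  refine ⟨isOpen_ball.prod isOpen_Ioo, ?_, ?_, ?_, ?_, ?_⟩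
  · exact hu.1.comp hmap.continuousOn hC
  · rintro y t ⟨hy, ht⟩
    have h1 := (hu.2.1 (s • y) (hin y hy) t ht.1 ENNReal.ofReal_lt_top).1
    exact ContDiffAt.comp y h1 (contDiff_const_smul s).contDiffAt
  · rintro y t ⟨hy, ht⟩
    exact (hu.2.1 (s • y) (hin y hy) t ht.1 ENNReal.ofReal_lt_top).2
  · exact hu.2.2.1.comp hmap.continuousOn hO
  · rintro y t ⟨hy, ht⟩
    refine ⟨A (s • y) t, s⁻¹ • b (s • y), hA.2 _ (hC ⟨hy, ht⟩), ?_, ?_⟩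
    · have h1 := hb.dist_le_mul (s • y) 0
      rw [hb0, dist_zero_right, dist_zero_right, norm_smul, Real.norm_of_nonneg hsp.le,
        Real.coe_toNNReal _ hLb] at h1
      rw [norm_smul, Real.norm_of_nonneg (by positivity), inv_mul_le_iff₀ hsp]
      simp only [mem_ball, dist_zero_right] at hy
      have : Lb * (s * ‖y‖) ≤ Lb * (s * R) := by gcongr
      linarith
    · rw [ks_sG_scale u s hsp.ne', ks_sH_scale u s hsp.ne', ks_trMul_smul, hs2, ks_dotp_eq,
        real_inner_smul_left, real_inner_smul_right, ← mul_assoc, inv_mul_cancel₀ hsp.ne', one_mul,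
        ← ks_dotp_eq]
      exact hL (s • y) (hin y hy) t ht.1 ENNReal.ofReal_lt_top

/-- Corollary 2.3 (consequence of the Harnack inequality): improvement of oscillation. -/
theorem stmt5 {n : ℕ} (m : ℕ) (θ₀ Lb : ℝ) (hθ : θ₀ ∈ Set.Ioc (0:ℝ) 1) (hLb : 0 ≤ Lb) :
    ∃ η ∈ Set.Ioo (0:ℝ) 1,
      ∀ (Ω : Set (Eu n)) (ν : Eu n → Eu n) (b : Eu n → Eu n) (b₀ r₀ : ℝ),
        IsBdC1With Ω ν → (0 : Eu n) ∈ Ω →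
        LipschitzWith (Real.toNNReal Lb) b → b 0 = 0 →
        0 < b₀ → 0 < r₀ → closedBall (0 : Eu n) r₀ ⊆ Ω →
        (∀ x ∈ ball (0 : Eu n) r₀, dotp (b x) x ≤ -b₀ * ‖x‖ ^ 2) →
        ∀ ε ∈ Set.Ioo (0:ℝ) 1,
        ∀ A : Eu n → ℝ → Matrix (Fin n) (Fin n) ℝ, MatC θ₀ A Ω ⊤ →
        ∀ u : Eu n → ℝ → ℝ, Classical21 u Ω ⊤ → SolveL ε A b u Ω ⊤ →
        ∀ T : ℝ, ((m : ℝ) + 2) * Real.sqrt ε ≤ r₀ → 4 * ((m : ℝ) + 1) < T →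
        (∀ t ∈ Set.Ioo (0:ℝ) T, u 0 t ≤ 0) →
        (∀ x ∈ ball (0 : Eu n) (((m : ℝ) + 2) * Real.sqrt ε),
            ∀ t ∈ Set.Ioo (0:ℝ) T, u x t ≤ 1) →
        ∀ x ∈ ball (0 : Eu n) ((m : ℝ) * Real.sqrt ε),
            ∀ t ∈ Set.Ioo (4 * ((m : ℝ) + 1)) T, u x t ≤ η := by
  rcases Nat.eq_zero_or_pos m with rfl | hm
  · refine ⟨1 / 2, by norm_num, ?_⟩
    intros
    rename_i x hx t ht
    simp at hx
  have hm1 : (1 : ℝ) ≤ m := by exact_mod_cast hm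
  obtain ⟨c, hc, H⟩ := ks_harnack (n := n) θ₀ (Lb * ((m : ℝ) + 2)) ((m : ℝ) + 2) hθ.1
    (by positivity) (by linarith)
  have hmin : 0 < min c (1 / 2) := lt_min hc (by norm_num)
  have hmin2 : min c (1 / 2) ≤ 1 / 2 := min_le_right _ _
  refine ⟨1 - min c (1 / 2), ⟨by linarith, by linarith⟩, ?_⟩
  intro Ω ν b b₀ r₀ _ _ hb hb0 _ _ hΩ _ ε hε A hA u hu hL T hr hT h0 h1 x hx t ht
  have hsp : 0 < Real.sqrt ε := Real.sqrt_pos.mpr hε.1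
  have hxe : Real.sqrt ε • ((Real.sqrt ε)⁻¹ • x) = x := smul_inv_smul₀ hsp.ne' x
  have hD : KDom θ₀ (Lb * ((m : ℝ) + 2)) ((m : ℝ) + 2) T ((Real.sqrt ε)⁻¹ • x) t
      (fun y t => 1 - u (Real.sqrt ε • y) t) := by
    refine ⟨(ks_rescale hLb (by positivity) hb hb0 hΩ hε.1 hA hu hL hr).const_sub 1, ?_,
      by linarith, ?_, by linarith [ht.1], ht.2⟩
    · intro y hy s hs
      have := h1 (Real.sqrt ε • y) (by
        simp only [mem_ball, dist_zero_right] at hy ⊢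
        rw [norm_smul, Real.norm_of_nonneg hsp.le]
        nlinarith) s hs
      linarith
    · simp only [mem_ball, dist_zero_right] at hx
      rw [norm_smul, Real.norm_of_nonneg (by positivity), inv_mul_le_iff₀ hsp]
      linarith
  have key := H _ _ _ _ hD (by
    have := h0 (t - 4) ⟨by linarith [ht.1], by linarith [ht.2]⟩
    simp only [smul_zero]
    linarith)
  simp only [hxe] at key
  have := min_le_left c (1 / 2)
  linarith
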